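/- There exists an absolute constant K>0 such that for every ψ∈𝔐_∞^+, every β∈ℝ, every (not necessarily convex) modulus of continuity ω, and every n∈ℕ with μ(ψ;n)>2, one has (4/(3π))·ψ(n)·e_n(ω) − K·γ_n(ψ)·ω(1/n) ≤ E_n(C^ψ_β H_{ω_C})_C ≤ (2/π)·ψ(n)·e_n(ω) + K·γ_n(ψ)·ω(1/n). -/

import Mathlib

open Real MeasureTheory Filter

noncomputable section

/-- `ω` is a modulus of continuity: continuous, nondecreasing, subadditive on `[0,∞)`,
nonnegative, and `ω 0 = 0`. -/
def IsModulus (ω : ℝ → ℝ) : Prop :=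
  ContinuousOn ω (Set.Ici 0) ∧ MonotoneOn ω (Set.Ici 0) ∧
  (∀ s t : ℝ, 0 ≤ s → 0 ≤ t → ω (s + t) ≤ ω s + ω t) ∧ ω 0 = 0 ∧
  ∀ t : ℝ, 0 ≤ t → 0 ≤ ω t

/-- `ψ` belongs to `𝔐_∞^+`, where `η t = ψ⁻¹(ψ t / 2)` (i.e. `η t ≥ t` and
`ψ (η t) = ψ t / 2`) and `μ t = t / (η t − t)` is nondecreasing and tends to `∞`. -/
def IsMInfPlus (ψ η : ℝ → ℝ) : Prop :=
  (∀ t ≥ (1:ℝ), 0 < ψ t) ∧ ContinuousOn ψ (Set.Ici 1) ∧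
  ConvexOn ℝ (Set.Ici 1) ψ ∧ Tendsto ψ atTop (nhds 0) ∧
  (∀ t ≥ (1:ℝ), t < η t ∧ ψ (η t) = ψ t / 2) ∧
  MonotoneOn (fun t => t / (η t - t)) (Set.Ici 1) ∧
  Tendsto (fun t => t / (η t - t)) atTop atTop

/-- `T` is a trigonometric polynomial of degree at most `n − 1`. -/
def IsTrigPoly (n : ℕ) (T : ℝ → ℝ) : Prop :=
  ∃ a b : ℕ → ℝ,
    ∀ x, T x = ∑ k ∈ Finset.range n, (a k * Real.cos (k * x) + b k * Real.sin (k * x))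

/-- The kernel `Ψ_β(t) = ∑_{k=1}^∞ ψ(k) cos(kt − βπ/2)`. -/
def PsiKer (ψ : ℝ → ℝ) (β : ℝ) (t : ℝ) : ℝ :=
  ∑' k : ℕ, ψ (k + 1) * Real.cos ((k + 1) * t - β * π / 2)

/-- The class `C^ψ_β H_{ω_C}`. -/
def CClass (ψ : ℝ → ℝ) (β : ℝ) (ω : ℝ → ℝ) : Set (ℝ → ℝ) :=
  {f | Continuous f ∧ Function.Periodic f (2 * π) ∧
    ∃ a₀ : ℝ, ∃ φ : ℝ → ℝ, Continuous φ ∧ Function.Periodic φ (2 * π) ∧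
      (∫ t in (-π)..π, φ t) = 0 ∧
      (∀ t : ℝ, 0 ≤ t → ∀ x h : ℝ, |h| ≤ t → |φ (x + h) - φ x| ≤ ω t) ∧
      ∀ x, f x = a₀ / 2 + (1 / π) * ∫ t in (-π)..π, φ (x - t) * PsiKer ψ β t}

/-- Best uniform approximation of `f` by trigonometric polynomials of degree `≤ n − 1`. -/
def EnC (n : ℕ) (f : ℝ → ℝ) : ℝ :=
  sInf {e | ∃ T : ℝ → ℝ, IsTrigPoly n T ∧ e = ⨆ x : ℝ, |f x - T x|}

/-- Best uniform approximation of a class of functions. -/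
def EnCClass (n : ℕ) (N : Set (ℝ → ℝ)) : ℝ := sSup (EnC n '' N)

/-- `e_n(ω) = ∫_0^{π/2} ω(2t/n) sin t dt`. -/
def eN (n : ℕ) (ω : ℝ → ℝ) : ℝ := ∫ t in (0:ℝ)..(π / 2), ω (2 * t / n) * Real.sin t

/-- `γ_n(ψ) = ψ(n+1)(1/n + 1/(μ(n)−2)) + ψ(3n)(1 + ln⁺(η(n)−n))`. -/
def gammaN (ψ η : ℝ → ℝ) (n : ℕ) : ℝ :=
  ψ (n + 1) * (1 / n + 1 / ((n : ℝ) / (η n - n) - 2)) +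
    ψ (3 * n) * (1 + max 0 (Real.log (η n - n)))


lemma psi_anti {ψ η : ℝ → ℝ} (h : IsMInfPlus ψ η) : AntitoneOn ψ (Set.Ici 1) := by
  obtain ⟨hpos, -, hconv, hlim, -⟩ := h
  intro a ha b hb hab
  by_contra hlt
  push Not at hlt
  have hab' : a < b := lt_of_le_of_ne hab (by rintro rfl; exact lt_irrefl _ hlt)
  have h1 : ∀ t, b < t → ψ b ≤ ψ t := by
    intro t ht
    have := hconv.slope_mono_adjacent ha (show t ∈ Set.Ici (1:ℝ) from le_trans hb ht.le) hab' ht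
    have h2 : 0 < (ψ b - ψ a) / (b - a) := div_pos (by linarith) (by linarith)
    have h3 : 0 < (ψ t - ψ b) / (t - b) := lt_of_lt_of_le h2 this
    have h4 : 0 < t - b := by linarith
    have := (div_pos_iff_of_pos_right h4).1 h3
    linarith
  have : ψ b ≤ 0 := by
    refine ge_of_tendsto hlim ?_
    filter_upwards [eventually_gt_atTop b] with t ht using h1 t ht
  linarith [hpos b hb]

lemma tail_sum {ψ η : ℝ → ℝ} (n μ : ℝ) (hμ : 2 < μ) (hn : 1 ≤ n)
    (hpos : ∀ t ≥ n, 0 ≤ ψ t) (hanti : ∀ s t, n ≤ s → s ≤ t → ψ t ≤ ψ s)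
    (hη : ∀ t ≥ n, t < η t ∧ ψ (η t) = ψ t / 2 ∧ η t - t ≤ t / μ) (h : ℝ) (hh : 0 < h) :
    ∀ (N : ℕ) (t : ℝ), n ≤ t →
      ∑ k ∈ Finset.range N, ψ (t + k * h) ≤ ψ t * (4 + 2 / (μ - 1) * (t / h)) := by
  intro N
  induction N using Nat.strong_induction_on with
  | _ N ih =>
  intro t ht
  obtain ⟨hη1, hη2, hη3⟩ := hη t ht
  have hψ := hpos t ht
  have ht0 : 0 < t := by linarith
  set m := ⌈(η t - t) / h⌉₊ with hm
  have hx0 : 0 < (η t - t) / h := div_pos (by linarith) hh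
  have hm1 : 1 ≤ m := Nat.one_le_ceil_iff.2 hx0
  have hm2 : (m : ℝ) < (η t - t) / h + 1 := Nat.ceil_lt_add_one hx0.le
  have hm3 : (η t - t) / h ≤ m := Nat.le_ceil _
  set T := t / h with hT
  have hTpos : 0 < T := div_pos ht0 hh
  have hq : (η t - t) / h ≤ T / μ := by
    rw [hT, div_right_comm]; exact div_le_div_of_nonneg_right hη3 hh.le
  have hc : 1 / μ + (1 / (μ - 1)) * (1 + 1 / μ) = 2 / (μ - 1) := by
    have : μ - 1 ≠ 0 := by linarith
    have : μ ≠ 0 := by linarith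
    field_simp; ring
  have hc0 : 0 < 1 / (μ - 1) := by apply div_pos one_pos; linarith
  have hc2 : 1 / (μ - 1) ≤ 1 := by rw [div_le_one (by linarith)]; linarith
  have hc3 : 2 / (μ - 1) = 2 * (1 / (μ - 1)) := by ring
  have hb : ∀ N' : ℕ, ∑ k ∈ Finset.range N', ψ (t + k * h) ≤ N' * ψ t := by
    intro N'
    calc _ ≤ ∑ k ∈ Finset.range N', ψ t := by
          apply Finset.sum_le_sum; intro k _
          apply hanti _ _ ht
          have : (0:ℝ) ≤ k * h := by positivity
          linarith
      _ = _ := by simp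
  have hTμ : T / μ = T * (1 / μ) := by ring
  have hμ0 : 0 < 1 / μ := by apply div_pos one_pos; linarith
  by_cases hNm : N ≤ m
  · refine (hb N).trans ?_
    rw [mul_comm]
    apply mul_le_mul_of_nonneg_left _ hψ
    have : (N:ℝ) ≤ m := by exact_mod_cast hNm
    have h5 : T * (1 / μ) ≤ 2 / (μ - 1) * T := by
      rw [← hc, mul_comm]
      apply mul_le_mul_of_nonneg_right _ hTpos.le
      have : 0 < (1 / (μ - 1)) * (1 + 1 / μ) := by positivity
      linarith
    linarith
  · push Not at hNm
    obtain ⟨N', rfl⟩ := Nat.exists_eq_add_of_le hNm.le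
    rw [Finset.sum_range_add]
    have hmh : η t ≤ t + m * h := by
      have := (div_le_iff₀ hh).1 hm3
      linarith
    have hmh2 : t + m * h ≤ η t + h := by
      have : (m:ℝ) - 1 < (η t - t) / h := by linarith
      have := (lt_div_iff₀ hh).1 this
      linarith
    have hi := ih N' (by omega) (t + m * h) (by linarith)
    have e : ∀ k : ℕ, t + ((m + k : ℕ) : ℝ) * h = t + m * h + k * h := by
      intro k; push_cast; ring
    simp_rw [e]
    have h6 : ψ (t + m * h) ≤ ψ t / 2 := by rw [← hη2]; exact hanti _ _ (by linarith) hmh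
    have h7 : (t + m * h) / h ≤ T * (1 + 1 / μ) + 1 := by
      rw [div_le_iff₀ hh]
      have : T * h = t := by rw [hT]; field_simp
      have h8 : η t ≤ t + t / μ := by linarith
      have : (T * (1 + 1 / μ) + 1) * h = t + t / μ + h := by
        rw [add_mul, mul_right_comm, this]; ring
      linarith
    have h8 : 4 + 2 / (μ - 1) * ((t + m * h) / h) ≤ 4 + 2 / (μ - 1) * (T * (1 + 1 / μ) + 1) := by
      gcongr
      rw [hc3]; positivity
    have h9 : 0 ≤ 4 + 2 / (μ - 1) * (T * (1 + 1 / μ) + 1) := by rw [hc3]; positivity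
    have h10 := mul_le_mul_of_nonneg_left h8 (hpos (t + m * h) (by linarith))
    have h11 := mul_le_mul_of_nonneg_right h6 h9
    have h12 := hb m
    have h13 : (m:ℝ) * ψ t ≤ (T * (1 / μ) + 1) * ψ t := by
      apply mul_le_mul_of_nonneg_right _ hψ; linarith
    have h14 : (T * (1 / μ) + 1) * ψ t + ψ t / 2 * (4 + 2 / (μ - 1) * (T * (1 + 1 / μ) + 1))
        ≤ ψ t * (4 + 2 / (μ - 1) * T) := by
      have : (T * (1 / μ) + 1) * ψ t + ψ t / 2 * (4 + 2 / (μ - 1) * (T * (1 + 1 / μ) + 1))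
        = ψ t * (3 + 1 / (μ - 1) + (1 / μ + (1 / (μ - 1)) * (1 + 1 / μ)) * T) := by
        rw [hc3]; ring
      rw [this, hc]
      apply mul_le_mul_of_nonneg_left _ hψ
      linarith
    linarith


/-- second difference -/
def dd (a : ℕ → ℝ) (m : ℕ) : ℝ := a m - 2 * a (m + 1) + a (m + 2)

/-- truncated convex sequence -/
def aM (a : ℕ → ℝ) (M j : ℕ) : ℝ := ∑ m ∈ Finset.range M, dd a m * ((m + 1 - j : ℕ) : ℝ)

lemma aM_eq (a : ℕ → ℝ) (j M : ℕ) (h : j ≤ M) :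
    aM a M j = a j - a M - ((M:ℝ) - j) * (a M - a (M + 1)) := by
  induction M, h using Nat.le_induction with
  | base =>
    unfold aM
    rw [Finset.sum_eq_zero]
    · ring
    · intro m hm
      have : m + 1 - j = 0 := by have := Finset.mem_range.1 hm; omega
      rw [this]; simp
  | succ M hM ih =>
    unfold aM at *
    rw [Finset.sum_range_succ, ih, Nat.cast_sub (by omega)]
    unfold dd
    push_cast
    ring_nf

lemma aM_nonneg {a : ℕ → ℝ} (hd : ∀ m, 0 ≤ dd a m) (M j : ℕ) : 0 ≤ aM a M j :=
  Finset.sum_nonneg fun m _ => mul_nonneg (hd m) (Nat.cast_nonneg _)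

lemma aM_le {a : ℕ → ℝ} (h0 : ∀ m, 0 ≤ a m) (ha : Antitone a)
    (M j : ℕ) : aM a M j ≤ a j := by
  rcases le_total j M with h | h
  · rw [aM_eq a j M h]
    have h1 : 0 ≤ ((M:ℝ) - j) * (a M - a (M + 1)) :=
      mul_nonneg (sub_nonneg.2 (by exact_mod_cast h)) (sub_nonneg.2 (ha (Nat.le_succ _)))
    linarith [h0 M]
  · unfold aM
    rw [Finset.sum_eq_zero]
    · exact h0 j
    · intro m hm
      have : m + 1 - j = 0 := by have := Finset.mem_range.1 hm; omega
      rw [this]; simp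

lemma aM_tendsto {a : ℕ → ℝ} (hd : ∀ m, 0 ≤ dd a m) (h0 : ∀ m, 0 ≤ a m) (ha : Antitone a)
    (hl : Tendsto a atTop (nhds 0)) (j : ℕ) :
    Tendsto (fun M => aM a M j) atTop (nhds (a j)) := by
  have hhalf : Tendsto (fun M : ℕ => M / 2) atTop atTop :=
    Nat.tendsto_div_const_atTop (by norm_num)
  have h1 : Tendsto (fun M : ℕ => a j - a M - 2 * a (M / 2)) atTop (nhds (a j)) := by
    have := ((tendsto_const_nhds (x := a j)).sub hl).sub ((hl.comp hhalf).const_mul 2)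
    simpa using this
  refine tendsto_of_tendsto_of_tendsto_of_le_of_le' h1 tendsto_const_nhds ?_ ?_
  · filter_upwards [eventually_ge_atTop j] with M hM
    rw [aM_eq a j M hM]
    have h2 := aM_nonneg hd M (M / 2)
    rw [aM_eq a (M / 2) M (Nat.div_le_self _ _)] at h2
    have h3 : 0 ≤ a M - a (M + 1) := sub_nonneg.2 (ha (Nat.le_succ _))
    have h4 : (((M / 2 : ℕ)) : ℝ) ≤ M / 2 := Nat.cast_div_le
    have h5 : ((M:ℝ) - j) * (a M - a (M + 1)) ≤ (2 * ((M:ℝ) - (M / 2 : ℕ))) * (a M - a (M + 1)) := by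
      apply mul_le_mul_of_nonneg_right _ h3
      have : (0:ℝ) ≤ j := Nat.cast_nonneg _
      linarith
    have := h0 M
    linarith
  · exact Eventually.of_forall fun M => aM_le h0 ha M j

lemma gauss_trunc (M m : ℕ) (h : m ≤ M) :
    2 * ∑ j ∈ Finset.range M, ((m - j : ℕ) : ℝ) = m * (m + 1) := by
  induction m with
  | zero => simp
  | succ k ih =>
    have e : ∑ j ∈ Finset.range M, ((k + 1 - j : ℕ) : ℝ)
        = ∑ j ∈ Finset.range M, (((k - j : ℕ) : ℝ) + if j ∈ Finset.range (k + 1) then 1 else 0) := by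
      apply Finset.sum_congr rfl
      intro j _
      split_ifs with hj
      · have := Finset.mem_range.1 hj
        have : k + 1 - j = (k - j) + 1 := by omega
        rw [this]; push_cast; ring
      · have : ¬ j < k + 1 := fun h => hj (Finset.mem_range.2 h)
        have h1 : k + 1 - j = 0 := by omega
        have h2 : k - j = 0 := by omega
        rw [h1, h2]; simp
    rw [e, Finset.sum_add_distrib, mul_add, ih (by omega), Finset.sum_ite_mem]
    have : Finset.range M ∩ Finset.range (k + 1) = Finset.range (k + 1) :=
      Finset.inter_eq_right.2 (Finset.range_subset_range.2 h)
    rw [this]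
    simp
    ring

lemma aM_sum (a : ℕ → ℝ) (M : ℕ) :
    ∑ m ∈ Finset.range M, dd a m * (m * (m + 1)) = 2 * ∑ j ∈ Finset.range M, aM a M (j + 1) := by
  unfold aM
  rw [Finset.sum_comm, Finset.mul_sum]
  apply Finset.sum_congr rfl
  intro m hm
  rw [← gauss_trunc M m (Finset.mem_range.1 hm).le, ← Finset.mul_sum]
  simp only [Nat.add_sub_add_right]
  ring

/-! trig polys -/

lemma IsTrigPoly.add {n : ℕ} {S T : ℝ → ℝ} (hS : IsTrigPoly n S) (hT : IsTrigPoly n T) :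
    IsTrigPoly n (fun x => S x + T x) := by
  obtain ⟨a, b, h⟩ := hS
  obtain ⟨c, d, h'⟩ := hT
  refine ⟨fun k => a k + c k, fun k => b k + d k, fun x => ?_⟩
  simp only [h, h']
  rw [← Finset.sum_add_distrib]
  apply Finset.sum_congr rfl; intro k _; ring

lemma IsTrigPoly.smul {n : ℕ} {S : ℝ → ℝ} (r : ℝ) (hS : IsTrigPoly n S) :
    IsTrigPoly n (fun x => r * S x) := by
  obtain ⟨a, b, h⟩ := hS
  refine ⟨fun k => r * a k, fun k => r * b k, fun x => ?_⟩
  simp only [h]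
  rw [Finset.mul_sum]
  apply Finset.sum_congr rfl; intro k _; ring

lemma IsTrigPoly.zero (n : ℕ) : IsTrigPoly n (fun _ => 0) :=
  ⟨fun _ => 0, fun _ => 0, fun x => by simp⟩

lemma IsTrigPoly.sum {ι : Type*} {n : ℕ} (s : Finset ι) {S : ι → ℝ → ℝ}
    (hS : ∀ i ∈ s, IsTrigPoly n (S i)) : IsTrigPoly n (fun x => ∑ i ∈ s, S i x) := by
  classical
  induction s using Finset.induction_on with
  | empty => simpa using IsTrigPoly.zero n
  | insert i s hi ih =>
    simp only [Finset.sum_insert hi]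
    exact (hS i (Finset.mem_insert_self _ _)).add
      (ih fun j hj => hS j (Finset.mem_insert_of_mem hj))

lemma IsTrigPoly.cos_nat {n k : ℕ} (h : k < n) (θ : ℝ) :
    IsTrigPoly n (fun x => Real.cos (k * x - θ)) := by
  refine ⟨fun i => if i = k then Real.cos θ else 0, fun i => if i = k then Real.sin θ else 0,
    fun x => ?_⟩
  rw [Finset.sum_eq_single k]
  · simp [Real.cos_sub]; ring
  · intro b _ hb; simp [hb]
  · intro h'; exact absurd (Finset.mem_range.2 h) h'

lemma IsTrigPoly.cos_int {n : ℕ} {k : ℤ} (h : |k| < n) (θ : ℝ) :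
    IsTrigPoly n (fun x => Real.cos (k * x - θ)) := by
  obtain ⟨m, rfl | rfl⟩ := k.eq_nat_or_neg
  · have h1 : m < n := by simpa using h
    simpa using IsTrigPoly.cos_nat h1 θ
  · have h1 : m < n := by simpa using h
    have := IsTrigPoly.cos_nat h1 (-θ)
    convert this using 2 with x
    rw [← Real.cos_neg]; congr 1; push_cast; ring

lemma IsTrigPoly.const {n : ℕ} (hn : 1 ≤ n) (c : ℝ) : IsTrigPoly n (fun _ => c) := by
  have := (IsTrigPoly.cos_nat (n := n) (k := 0) (by omega) 0).smul c
  simpa using this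

lemma IsTrigPoly.continuous {n : ℕ} {S : ℝ → ℝ} (hS : IsTrigPoly n S) : Continuous S := by
  obtain ⟨a, b, h⟩ := hS
  have : S = fun x => ∑ k ∈ Finset.range n, (a k * Real.cos (k * x) + b k * Real.sin (k * x)) :=
    funext h
  rw [this]; fun_prop

lemma IsTrigPoly.bounded {n : ℕ} {S : ℝ → ℝ} (hS : IsTrigPoly n S) : ∃ C, ∀ x, |S x| ≤ C := by
  obtain ⟨a, b, h⟩ := hS
  refine ⟨∑ k ∈ Finset.range n, (|a k| + |b k|), fun x => ?_⟩
  rw [h]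
  refine (Finset.abs_sum_le_sum_abs _ _).trans (Finset.sum_le_sum fun k _ => ?_)
  refine (abs_add_le _ _).trans ?_
  rw [abs_mul, abs_mul]
  exact add_le_add (mul_le_of_le_one_right (abs_nonneg _) (Real.abs_cos_le_one _))
    (mul_le_of_le_one_right (abs_nonneg _) (Real.abs_sin_le_one _))

lemma IsTrigPoly.conv {n : ℕ} {S : ℝ → ℝ} (hS : IsTrigPoly n S) {Q : ℝ → ℝ} (hQ : Continuous Q)
    (u v : ℝ) : IsTrigPoly n (fun x => ∫ t in u..v, S (x - t) * Q t) := by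
  obtain ⟨a, b, h⟩ := hS
  refine ⟨fun k => ∫ t in u..v, (a k * Real.cos (k * t) - b k * Real.sin (k * t)) * Q t,
    fun k => ∫ t in u..v, (a k * Real.sin (k * t) + b k * Real.cos (k * t)) * Q t, fun x => ?_⟩
  simp only [h, Finset.sum_mul]
  rw [intervalIntegral.integral_finsetSum]
  · apply Finset.sum_congr rfl; intro k _
    rw [← intervalIntegral.integral_mul_const, ← intervalIntegral.integral_mul_const,
      ← intervalIntegral.integral_add]
    · congr 1; ext t
      rw [mul_sub, Real.cos_sub, Real.sin_sub]; ring
    · apply Continuous.intervalIntegrable; fun_prop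
    · apply Continuous.intervalIntegrable; fun_prop
  · intro k _; apply Continuous.intervalIntegrable; fun_prop


def CC (a : ℕ → ℝ) (N : ℕ) (t : ℝ) : ℝ := ∑ k ∈ Finset.range N, a k * Real.cos (k * t)
def SS (a : ℕ → ℝ) (N : ℕ) (t : ℝ) : ℝ := ∑ k ∈ Finset.range N, a k * Real.sin (k * t)
def JJ (a : ℕ → ℝ) (N : ℕ) (t : ℝ) : ℝ := CC a N t ^ 2 + SS a N t ^ 2

lemma CC_cont (a : ℕ → ℝ) (N : ℕ) : Continuous (CC a N) := by unfold CC; fun_prop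
lemma SS_cont (a : ℕ → ℝ) (N : ℕ) : Continuous (SS a N) := by unfold SS; fun_prop
lemma JJ_cont (a : ℕ → ℝ) (N : ℕ) : Continuous (JJ a N) :=
  ((CC_cont a N).pow 2).add ((SS_cont a N).pow 2)
lemma JJ_nonneg (a : ℕ → ℝ) (N : ℕ) (t : ℝ) : 0 ≤ JJ a N t := by unfold JJ; positivity

lemma JJ_exp (a : ℕ → ℝ) (N : ℕ) (t : ℝ) :
    JJ a N t = ∑ k ∈ Finset.range N, ∑ l ∈ Finset.range N,
      a k * a l * Real.cos (((k - l : ℤ) : ℝ) * t) := by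
  unfold JJ CC SS
  rw [sq, sq, Finset.sum_mul_sum, Finset.sum_mul_sum, ← Finset.sum_add_distrib]
  apply Finset.sum_congr rfl; intro k _
  rw [← Finset.sum_add_distrib]
  apply Finset.sum_congr rfl; intro l _
  push_cast
  rw [sub_mul, Real.cos_sub]; ring

lemma int_cos (k : ℤ) : ∫ t in (-π)..π, Real.cos (k * t) = if k = 0 then 2 * π else 0 := by
  split_ifs with h
  · subst h; simp; ring
  · have hk : (k:ℝ) ≠ 0 := by exact_mod_cast h
    rw [intervalIntegral.integral_comp_mul_left (fun x => Real.cos x) hk, integral_cos]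
    have h1 : Real.sin (k * π) = 0 := Real.sin_int_mul_pi k
    rw [mul_neg, Real.sin_neg, h1]; simp

lemma JJ_int (a : ℕ → ℝ) (N : ℕ) :
    ∫ t in (-π)..π, JJ a N t = 2 * π * ∑ k ∈ Finset.range N, a k ^ 2 := by
  simp_rw [JJ_exp]
  rw [intervalIntegral.integral_finsetSum]
  · rw [Finset.mul_sum]
    apply Finset.sum_congr rfl; intro k hk
    rw [intervalIntegral.integral_finsetSum]
    · rw [Finset.sum_eq_single k]
      · rw [intervalIntegral.integral_const_mul, int_cos]; simp; ring
      · intro l _ hl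
        rw [intervalIntegral.integral_const_mul, int_cos, if_neg]
        · simp
        · omega
      · intro h; exact absurd hk h
    · intro l _; apply Continuous.intervalIntegrable; fun_prop
  · intro l _; apply Continuous.intervalIntegrable; fun_prop

lemma JJ_trig {n N : ℕ} (h : N ≤ n) (a : ℕ → ℝ) : IsTrigPoly n (JJ a N) := by
  have : JJ a N = fun t => ∑ k ∈ Finset.range N, ∑ l ∈ Finset.range N,
      a k * a l * Real.cos (((k - l : ℤ) : ℝ) * t) := funext (JJ_exp a N)
  rw [this]
  refine IsTrigPoly.sum _ fun k hk => IsTrigPoly.sum _ fun l hl => IsTrigPoly.smul _ ?_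
  have hk := Finset.mem_range.1 hk
  have hl := Finset.mem_range.1 hl
  have := IsTrigPoly.cos_int (n := n) (k := (k - l : ℤ)) (by rw [abs_lt]; omega) 0
  simpa using this

lemma conv_comm {φ T : ℝ → ℝ} (hφ : Function.Periodic φ (2 * π)) (hT : Function.Periodic T (2 * π))
    (x : ℝ) :
    ∫ t in (-π)..π, φ (x - t) * T t = ∫ u in (-π)..π, T (x - u) * φ u := by
  have h1 := intervalIntegral.integral_comp_sub_left (a := -π) (b := π)
    (fun u => T (x - u) * φ u) x
  have h2 : ∀ t, (fun u => T (x - u) * φ u) (x - t) = φ (x - t) * T t := by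
    intro t; simp; ring
  simp only [h2] at h1
  rw [h1]
  have hp : Function.Periodic (fun u => T (x - u) * φ u) (2 * π) := by
    intro u
    simp only [hφ u]
    rw [← sub_sub, hT.sub_eq]
  have := hp.intervalIntegral_add_eq (x - π) (-π)
  convert this using 2 <;> ring

lemma IsTrigPoly.periodic {n : ℕ} {S : ℝ → ℝ} (hS : IsTrigPoly n S) :
    Function.Periodic S (2 * π) := by
  obtain ⟨a, b, h⟩ := hS
  intro x
  rw [h, h]
  apply Finset.sum_congr rfl; intro k _
  have e : (k:ℝ) * (x + 2 * π) = k * x + k * (2 * π) := by ring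
  rw [e, Real.cos_add_nat_mul_two_pi, Real.sin_add_nat_mul_two_pi]

lemma IsTrigPoly.conv' {n : ℕ} {T φ : ℝ → ℝ} (hT : IsTrigPoly n T) (hφ : Continuous φ)
    (hp : Function.Periodic φ (2 * π)) :
    IsTrigPoly n (fun x => ∫ t in (-π)..π, φ (x - t) * T t) := by
  simp_rw [conv_comm hp hT.periodic]
  exact hT.conv hφ _ _

/-! Jackson -/

def HM (ω φ : ℝ → ℝ) : Prop := ∀ t : ℝ, 0 ≤ t → ∀ x h : ℝ, |h| ≤ t → |φ (x + h) - φ x| ≤ ω t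

lemma om_nat {ω : ℝ → ℝ} (hω : IsModulus ω) (k : ℕ) {s : ℝ} (hs : 0 ≤ s) :
    ω (k * s) ≤ k * ω s := by
  obtain ⟨-, -, hsub, h0, -⟩ := hω
  induction k with
  | zero => simp [h0]
  | succ k ih =>
    push_cast
    rw [add_mul, one_mul, add_mul, one_mul]
    exact (hsub _ _ (by positivity) hs).trans (by linarith)

lemma om_le {ω : ℝ → ℝ} (hω : IsModulus ω) {n : ℕ} (hn : 1 ≤ n) {t : ℝ} (ht : 0 ≤ t) :
    ω t ≤ (1 + n * t) * ω (1 / n) := by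
  have hn' : (0:ℝ) < n := by exact_mod_cast hn
  have h1 : (0:ℝ) ≤ 1 / n := by positivity
  have h2 : (n * t : ℝ) ≤ ⌈(n * t : ℝ)⌉₊ := Nat.le_ceil _
  have h3 : (⌈(n * t : ℝ)⌉₊ : ℝ) < n * t + 1 := Nat.ceil_lt_add_one (by positivity)
  have h4 : t ≤ (⌈(n * t : ℝ)⌉₊ : ℝ) * (1 / n) := by
    rw [mul_one_div, le_div_iff₀ hn']; linarith
  calc ω t ≤ ω ((⌈(n * t : ℝ)⌉₊ : ℝ) * (1 / n)) :=
        hω.2.1 ht (show (0:ℝ) ≤ _ by positivity) h4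
    _ ≤ _ := om_nat hω _ h1
    _ ≤ _ := mul_le_mul_of_nonneg_right (by linarith) (hω.2.2.2.2 _ h1)

lemma jack_rec (x : ℝ) (t : ℝ) (N : ℕ) :
    (1 - Real.cos t) * CC (fun k => (k + 1) * (x - k)) N t
      + Real.sin t * SS (fun k => (k + 1) * (x - k)) N t
      = CC (fun k => x - 2 * k) N t - N * (x - N + 1) * Real.cos (N * t) ∧
    (1 - Real.cos t) * SS (fun k => (k + 1) * (x - k)) N t
      - Real.sin t * CC (fun k => (k + 1) * (x - k)) N t
      = SS (fun k => x - 2 * k) N t - N * (x - N + 1) * Real.sin (N * t) := by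
  induction N with
  | zero => simp [CC, SS]
  | succ N ih =>
    obtain ⟨h1, h2⟩ := ih
    unfold CC SS at *
    simp only [Finset.sum_range_succ]
    push_cast
    have e : ((N:ℝ) + 1) * t = N * t + t := by ring
    rw [e, Real.cos_add, Real.sin_add]
    constructor
    · linear_combination h1
    · linear_combination h2

lemma jack_id (n : ℕ) (t : ℝ) :
    2 * (1 - Real.cos t) * JJ (fun k => (k + 1) * ((n:ℝ) - k)) n t
      = JJ (fun k => (n:ℝ) - 2 * k) (n + 1) t := by
  obtain ⟨h1, h2⟩ := jack_rec n t n
  have e1 : CC (fun k => (n:ℝ) - 2 * k) (n + 1) t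
      = (1 - Real.cos t) * CC (fun k => (k + 1) * ((n:ℝ) - k)) n t
      + Real.sin t * SS (fun k => (k + 1) * ((n:ℝ) - k)) n t := by
    rw [h1]; unfold CC; rw [Finset.sum_range_succ]; ring
  have e2 : SS (fun k => (n:ℝ) - 2 * k) (n + 1) t
      = (1 - Real.cos t) * SS (fun k => (k + 1) * ((n:ℝ) - k)) n t
      - Real.sin t * CC (fun k => (k + 1) * ((n:ℝ) - k)) n t := by
    rw [h2]; unfold SS; rw [Finset.sum_range_succ]; ring
  unfold JJ
  rw [e1, e2]
  have := Real.sin_sq_add_cos_sq t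
  generalize CC (fun k => (k + 1) * ((n:ℝ) - k)) n t = c
  generalize SS (fun k => (k + 1) * ((n:ℝ) - k)) n t = s
  linear_combination (-(c ^ 2 + s ^ 2)) * this

lemma sumA (x : ℝ) (N : ℕ) : ∑ k ∈ Finset.range N, ((k + 1) * (x - k)) ^ 2
    = (N:ℝ)^5/5 - N^4*x/2 + N^3*x^2/3 - N^3/3 + N^2*x^2/2 + N^2*x/2 + N*x^2/6 + 2*N/15 - N^3*x/3 + N*x/3 := by
  induction N with
  | zero => simp
  | succ N ih => rw [Finset.sum_range_succ, ih]; push_cast; ring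

lemma sumB (x : ℝ) (N : ℕ) : ∑ k ∈ Finset.range N, (x - 2 * k) ^ 2
    = 4*(N:ℝ)^3/3 - 2*N^2*x - 2*N^2 + N*x^2 + 2*N*x + 2*N/3 := by
  induction N with
  | zero => simp
  | succ N ih => rw [Finset.sum_range_succ, ih]; push_cast; ring

lemma cos_low {t : ℝ} (h : |t| ≤ π) : t ^ 2 ≤ π ^ 2 / 2 * (1 - Real.cos t) := by
  have := Real.cos_le_one_sub_mul_cos_sq (x := t) h
  have hp := Real.pi_pos
  have e : t ^ 2 = π ^ 2 / 2 * (2 / π ^ 2 * t ^ 2) := by field_simp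
  rw [e]
  apply mul_le_mul_of_nonneg_left _ (by positivity)
  linarith

lemma jackson {ω φ : ℝ → ℝ} (hω : IsModulus ω) (hφ : Continuous φ)
    (hp : Function.Periodic φ (2 * π)) (hm : HM ω φ) {n : ℕ} (hn : 1 ≤ n) :
    ∃ T, IsTrigPoly n T ∧ ∀ x, |φ x - T x| ≤ 27 * ω (1 / n) := by
  have hn' : (1:ℝ) ≤ n := by exact_mod_cast hn
  set a : ℕ → ℝ := fun k => (k + 1) * ((n:ℝ) - k) with ha
  set b : ℕ → ℝ := fun k => (n:ℝ) - 2 * k with hb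
  set A := ∑ k ∈ Finset.range n, a k ^ 2 with hA
  set B := ∑ k ∈ Finset.range (n + 1), b k ^ 2 with hB
  have hAe : A = n * (n + 1) * (n + 2) * (n ^ 2 + 2 * n + 2) / 30 := by
    rw [hA, ha, sumA]; ring
  have hBe : B = n * (n + 1) * (n + 2) / 3 := by
    rw [hB, hb, sumB]; push_cast; ring
  have hApos : 0 < A := by rw [hAe]; positivity
  have hAB : n ^ 2 * B ≤ 10 * A := by
    rw [hAe, hBe]
    have h1 : (0:ℝ) ≤ n * (n + 1) * (n + 2) / 3 * (2 * n + 2) := by positivity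
    nlinarith
  have hIa : _ = 2 * π * A := JJ_int a n
  have hIb : _ = 2 * π * B := JJ_int b (n + 1)
  have hw : 0 ≤ ω (1 / n) := hω.2.2.2.2 _ (by positivity)
  refine ⟨fun x => (1 / (2 * π * A)) * ∫ t in (-π)..π, φ (x - t) * JJ a n t,
    ((JJ_trig le_rfl a).conv' hφ hp).smul _, fun x => ?_⟩
  have hpi := Real.pi_pos
  have hJc := JJ_cont a n
  have hJc' := JJ_cont b (n + 1)
  have e1 : φ x = (1 / (2 * π * A)) * ∫ t in (-π)..π, φ x * JJ a n t := by
    rw [intervalIntegral.integral_const_mul, hIa]; field_simp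
  have e2 : φ x - (1 / (2 * π * A)) * ∫ t in (-π)..π, φ (x - t) * JJ a n t
      = (1 / (2 * π * A)) * ∫ t in (-π)..π, (φ x - φ (x - t)) * JJ a n t := by
    nth_rewrite 1 [e1]
    rw [← mul_sub, ← intervalIntegral.integral_sub]
    · congr 2; ext t; ring
    · apply Continuous.intervalIntegrable; fun_prop
    · apply Continuous.intervalIntegrable; fun_prop
  have e3 : |∫ t in (-π)..π, (φ x - φ (x - t)) * JJ a n t|
      ≤ ∫ t in (-π)..π, ω (1 / n) * (2 * JJ a n t + n ^ 2 * (π ^ 2 / 4) * JJ b (n + 1) t) := by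
    rw [← Real.norm_eq_abs]
    apply intervalIntegral.norm_integral_le_of_norm_le (by linarith)
    · refine Eventually.of_forall fun t ht => ?_
      have habs : |t| ≤ π := abs_le.2 ⟨ht.1.le, ht.2⟩
      have h1 : |φ x - φ (x - t)| ≤ ω |t| := by
        have := hm |t| (abs_nonneg t) (x - t) t le_rfl
        simpa using this
      have h2 := om_le hω hn (abs_nonneg t)
      have h3 : 1 + n * |t| ≤ 2 + n ^ 2 * (π ^ 2 / 2 * (1 - Real.cos t)) := by
        have h4 := cos_low habs
        have h5 : (n:ℝ) ^ 2 * t ^ 2 ≤ n ^ 2 * (π ^ 2 / 2 * (1 - Real.cos t)) := by gcongr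
        have h6 : (n * |t|) ^ 2 = (n:ℝ) ^ 2 * t ^ 2 := by rw [mul_pow, sq_abs]
        nlinarith [sq_nonneg ((n:ℝ) * |t| - 1)]
      rw [norm_mul, Real.norm_eq_abs, Real.norm_eq_abs, abs_of_nonneg (JJ_nonneg a n t)]
      have h7 : ω (1 / n) * (2 * JJ a n t + n ^ 2 * (π ^ 2 / 4) * JJ b (n + 1) t)
          = ((2 + n ^ 2 * (π ^ 2 / 2 * (1 - Real.cos t))) * ω (1 / n)) * JJ a n t := by
        rw [← jack_id n t]; ring
      rw [h7]
      apply mul_le_mul_of_nonneg_right _ (JJ_nonneg a n t)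
      exact h1.trans (h2.trans (mul_le_mul_of_nonneg_right h3 hw))
    · apply Continuous.intervalIntegrable; fun_prop
  rw [e2, abs_mul, abs_of_pos (by positivity)]
  rw [intervalIntegral.integral_const_mul, intervalIntegral.integral_add,
    intervalIntegral.integral_const_mul, intervalIntegral.integral_const_mul, hIa, hIb] at e3
  · have h8 : (1 / (2 * π * A)) * |∫ t in (-π)..π, (φ x - φ (x - t)) * JJ a n t|
        ≤ (1 / (2 * π * A)) * (ω (1 / n) * (2 * (2 * π * A) + n ^ 2 * (π ^ 2 / 4) * (2 * π * B))) := by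
      gcongr
    refine h8.trans ?_
    have h9 : (1 / (2 * π * A)) * (ω (1 / n) * (2 * (2 * π * A) + n ^ 2 * (π ^ 2 / 4) * (2 * π * B)))
        = ω (1 / n) * (2 + (π ^ 2 / 4) * (n ^ 2 * B / A)) := by
      field_simp
    rw [h9, mul_comm]
    apply mul_le_mul_of_nonneg_right _ hw
    have h10 : n ^ 2 * B / A ≤ 10 := by rw [div_le_iff₀ hApos]; exact hAB
    have h11 : π ^ 2 ≤ 10 := by nlinarith [Real.pi_lt_d2]
    have h12 : π ^ 2 / 4 * (n ^ 2 * B / A) ≤ 10 / 4 * 10 := by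
      apply mul_le_mul (by linarith) h10 _ (by norm_num)
      have : 0 ≤ B := by rw [hBe]; positivity
      positivity
    linarith
  · apply Continuous.intervalIntegrable; fun_prop
  · apply Continuous.intervalIntegrable; fun_prop


/-- Fejer-type kernel -/
def KK (m : ℕ) (t : ℝ) : ℝ := JJ (fun _ => 1) (m + 1) t

lemma KK_cont (m : ℕ) : Continuous (KK m) := JJ_cont _ _
lemma KK_nonneg (m : ℕ) (t : ℝ) : 0 ≤ KK m t := JJ_nonneg _ _ _
lemma KK_int (m : ℕ) : ∫ t in (-π)..π, KK m t = 2 * π * (m + 1) := by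
  unfold KK; rw [JJ_int]; simp
lemma KK_per (m : ℕ) : Function.Periodic (KK m) (2 * π) := (JJ_trig (le_refl (m+1)) _).periodic

def KKd (m : ℕ) (t : ℝ) : ℝ :=
  2 * (CC (fun _ => 1) (m + 1) t * (- SS (fun k => (k:ℝ)) (m + 1) t)
    + SS (fun _ => 1) (m + 1) t * CC (fun k => (k:ℝ)) (m + 1) t)

lemma KKd_cont (m : ℕ) : Continuous (KKd m) := by
  have := CC_cont (fun _ => 1) (m + 1)
  have := SS_cont (fun _ => 1) (m + 1)
  have := CC_cont (fun k => (k:ℝ)) (m + 1)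
  have := SS_cont (fun k => (k:ℝ)) (m + 1)
  unfold KKd; fun_prop

lemma KK_deriv (m : ℕ) (t : ℝ) : HasDerivAt (KK m) (KKd m t) t := by
  have h1 : HasDerivAt (CC (fun _ => 1) (m + 1)) (- SS (fun k => (k:ℝ)) (m + 1) t) t := by
    unfold CC SS
    rw [← Finset.sum_neg_distrib]
    apply HasDerivAt.fun_sum
    intro k _
    have := ((hasDerivAt_id t).const_mul (k:ℝ)).cos.const_mul (1:ℝ)
    refine HasDerivAt.congr_deriv this ?_
    simp only [id]; ring
  have h2 : HasDerivAt (SS (fun _ => 1) (m + 1)) (CC (fun k => (k:ℝ)) (m + 1) t) t := by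
    unfold CC SS
    apply HasDerivAt.fun_sum
    intro k _
    have := ((hasDerivAt_id t).const_mul (k:ℝ)).sin.const_mul (1:ℝ)
    refine HasDerivAt.congr_deriv this ?_
    simp only [id]; ring
  have := (h1.fun_pow 2).fun_add (h2.fun_pow 2)
  refine HasDerivAt.congr_deriv this ?_
  unfold KKd
  push_cast; ring

lemma KKd_int (m : ℕ) : ∫ t in (-π)..π, |KKd m t| ≤ 4 * π * (m * (m + 1)) := by
  have hpi := Real.pi_pos
  rcases Nat.eq_zero_or_pos m with rfl | hm
  · simp [KKd, CC, SS]
  · have hm' : (0:ℝ) < m := by exact_mod_cast hm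
    have c1 := JJ_cont (fun _ => 1) (m + 1)
    have c2 := JJ_cont (fun k => (k:ℝ)) (m + 1)
    have c3 := KKd_cont m
    have h : ∫ t in (-π)..π, m * |KKd m t|
        ≤ ∫ t in (-π)..π, ((m:ℝ) ^ 2 * JJ (fun _ => 1) (m + 1) t
          + JJ (fun k => (k:ℝ)) (m + 1) t) := by
      apply intervalIntegral.integral_mono_on (by linarith)
      · apply Continuous.intervalIntegrable; fun_prop
      · apply Continuous.intervalIntegrable; fun_prop
      · intro t _
        unfold KKd JJ
        generalize CC (fun _ => 1) (m + 1) t = a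
        generalize SS (fun _ => 1) (m + 1) t = b
        generalize CC (fun k => (k:ℝ)) (m + 1) t = c
        generalize SS (fun k => (k:ℝ)) (m + 1) t = d
        rw [← abs_of_pos hm', ← abs_mul, abs_of_pos hm', abs_le]
        constructor
        · nlinarith [sq_nonneg (m * a - d), sq_nonneg (m * b + c)]
        · nlinarith [sq_nonneg (m * a + d), sq_nonneg (m * b - c)]
    rw [intervalIntegral.integral_const_mul, intervalIntegral.integral_add,
      intervalIntegral.integral_const_mul, JJ_int, JJ_int] at h
    · have h2 : ∑ k ∈ Finset.range (m + 1), (k:ℝ) ^ 2 ≤ (m + 1) * m ^ 2 := by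
        calc _ ≤ ∑ k ∈ Finset.range (m + 1), (m:ℝ) ^ 2 := by
              apply Finset.sum_le_sum; intro k hk
              have : (k:ℝ) ≤ m := by exact_mod_cast Nat.lt_succ_iff.1 (Finset.mem_range.1 hk)
              gcongr
          _ = _ := by simp
      have h3 : 2 * π * ∑ k ∈ Finset.range (m + 1), (k:ℝ) ^ 2 ≤ 2 * π * ((m + 1) * m ^ 2) := by
        gcongr
      simp at h
      have h4 : (m:ℝ) * ∫ t in (-π)..π, |KKd m t| ≤ m * (4 * π * (m * (m + 1))) := by
        nlinarith
      exact le_of_mul_le_mul_left h4 hm'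
    · apply Continuous.intervalIntegrable; fun_prop
    · apply Continuous.intervalIntegrable; fun_prop

lemma cell_osc (m : ℕ) {u v : ℝ} (huv : u < v) :
    ∫ t in u..v, |KK m t - (1 / (v - u)) * ∫ s in u..v, KK m s|
      ≤ (v - u) * ∫ t in u..v, |KKd m t| := by
  have hvu : 0 < v - u := by linarith
  have c1 := KK_cont m
  have c3 := KKd_cont m
  have c4 : Continuous fun t => |KKd m t| := c3.abs
  set I := ∫ t in u..v, |KKd m t| with hI
  have h1 : ∀ s ∈ Set.Icc u v, ∀ t ∈ Set.Icc u v, |KK m t - KK m s| ≤ I := by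
    intro s hs t ht
    have e : ∫ r in s..t, KKd m r = KK m t - KK m s :=
      intervalIntegral.integral_eq_sub_of_hasDerivAt (fun r _ => KK_deriv m r)
        (c3.intervalIntegrable _ _)
    rw [← e]
    rw [← Real.norm_eq_abs]
    refine (intervalIntegral.norm_integral_le_abs_integral_norm).trans ?_
    simp only [Real.norm_eq_abs]
    rcases le_total s t with hst | hst
    · rw [abs_of_nonneg (intervalIntegral.integral_nonneg hst fun _ _ => abs_nonneg _)]
      exact intervalIntegral.integral_mono_interval hs.1 hst ht.2
        (Eventually.of_forall fun _ => abs_nonneg _) (c4.intervalIntegrable _ _)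
    · rw [intervalIntegral.integral_symm, abs_neg,
        abs_of_nonneg (intervalIntegral.integral_nonneg hst fun _ _ => abs_nonneg _)]
      exact intervalIntegral.integral_mono_interval ht.1 hst hs.2
        (Eventually.of_forall fun _ => abs_nonneg _) (c4.intervalIntegrable _ _)
  have h2 : ∀ t ∈ Set.Icc u v, |KK m t - (1 / (v - u)) * ∫ s in u..v, KK m s| ≤ I := by
    intro t ht
    have e : KK m t - (1 / (v - u)) * ∫ s in u..v, KK m s
        = (1 / (v - u)) * ∫ s in u..v, (KK m t - KK m s) := by
      rw [intervalIntegral.integral_sub, intervalIntegral.integral_const, smul_eq_mul]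
      · field_simp
      · exact intervalIntegrable_const
      · exact c1.intervalIntegrable _ _
    rw [e, abs_mul, abs_of_pos (by positivity)]
    have := intervalIntegral.norm_integral_le_of_norm_le_const (a := u) (b := v) (C := I)
      (f := fun s => KK m t - KK m s) (by
        intro s hs
        rw [Set.uIoc_of_le huv.le] at hs
        exact h1 s ⟨hs.1.le, hs.2⟩ t ht)
    rw [Real.norm_eq_abs, abs_of_pos hvu] at this
    rw [one_div, inv_mul_le_iff₀ hvu]; linarith
  calc _ ≤ ∫ t in u..v, I := by
        apply intervalIntegral.integral_mono_on huv.le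
        · apply Continuous.intervalIntegrable; fun_prop
        · exact intervalIntegrable_const
        · exact h2
    _ = _ := by simp

lemma om_int {ω : ℝ → ℝ} (hω : IsModulus ω) (n : ℕ) :
    IntervalIntegrable (fun t => ω (2 * t / n) * Real.sin t) volume 0 (π / 2) := by
  apply ContinuousOn.intervalIntegrable
  rw [Set.uIcc_of_le (by positivity)]
  refine ContinuousOn.mul (hω.1.comp (by fun_prop) ?_) (by fun_prop)
  intro t ht
  have := ht.1
  show (0:ℝ) ≤ _
  positivity

lemma eN_nonneg {ω : ℝ → ℝ} (hω : IsModulus ω) (n : ℕ) : 0 ≤ eN n ω := by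
  apply intervalIntegral.integral_nonneg (by positivity)
  intro t ht
  have := ht.1
  exact mul_nonneg (hω.2.2.2.2 _ (by positivity))
    (Real.sin_nonneg_of_nonneg_of_le_pi ht.1 (by linarith [ht.2, Real.pi_pos]))

lemma half_wave {ω g : ℝ → ℝ} (hω : IsModulus ω) (hg : Continuous g) (hm : HM ω g) {n : ℕ}
    (hn : 1 ≤ n) : |∫ v in (0:ℝ)..π, g (v / n) * Real.cos v| ≤ eN n ω := by
  have hn' : (0:ℝ) < n := by exact_mod_cast hn
  have hpi := Real.pi_pos
  have e1 : ∫ v in (0:ℝ)..π, g (v / n) * Real.cos v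
      = ∫ u in (-(π/2))..(π/2), g ((π / 2 - u) / n) * Real.sin u := by
    have := intervalIntegral.integral_comp_sub_left (a := -(π/2)) (b := π/2)
      (fun v => g (v / n) * Real.cos v) (π / 2)
    simp only [Real.cos_pi_div_two_sub] at this
    rw [this]
    congr 1 <;> ring
  have c : Continuous fun u => g ((π / 2 - u) / n) * Real.sin u := by fun_prop
  have c' : Continuous fun u => g ((π / 2 + u) / n) * Real.sin u := by fun_prop
  have e2 : ∫ u in (-(π/2))..0, g ((π / 2 - u) / n) * Real.sin u
      = - ∫ u in (0:ℝ)..(π/2), g ((π / 2 + u) / n) * Real.sin u := by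
    have := intervalIntegral.integral_comp_neg (a := 0) (b := π/2)
      (fun u => g ((π / 2 - u) / n) * Real.sin u)
    simp only [neg_zero] at this
    rw [← this, ← intervalIntegral.integral_neg]
    congr 1; ext u; rw [Real.sin_neg, sub_neg_eq_add]; ring
  rw [e1, ← intervalIntegral.integral_add_adjacent_intervals (b := 0)
    (c.intervalIntegrable _ _) (c.intervalIntegrable _ _), e2, neg_add_eq_sub,
    ← intervalIntegral.integral_sub (c.intervalIntegrable _ _) (c'.intervalIntegrable _ _)]
  rw [← Real.norm_eq_abs]
  apply intervalIntegral.norm_integral_le_of_norm_le (by positivity) _ (om_int hω n)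
  refine Eventually.of_forall fun u hu => ?_
  have hs : 0 ≤ Real.sin u := Real.sin_nonneg_of_nonneg_of_le_pi hu.1.le (by linarith [hu.2])
  rw [← sub_mul, norm_mul, Real.norm_eq_abs, Real.norm_eq_abs, abs_of_nonneg hs]
  apply mul_le_mul_of_nonneg_right _ hs
  have hu0 := hu.1.le
  have := hm (2 * u / n) (by positivity) ((π / 2 + u) / n) (- (2 * u / n))
    (by rw [abs_neg, abs_of_nonneg (by positivity)])
  have e : (π / 2 + u) / n + -(2 * u / n) = (π / 2 - u) / n := by ring
  rw [e] at this; exact this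

lemma cell_wave {ω φ : ℝ → ℝ} (hω : IsModulus ω) (hφ : Continuous φ) (hm : HM ω φ) {n : ℕ}
    (hn : 1 ≤ n) (x θ : ℝ) (k : ℕ) :
    |∫ t in (θ / n + k * (π / n))..(θ / n + (k + 1 : ℕ) * (π / n)),
      φ (x - t) * Real.cos (n * t - θ)| ≤ eN n ω / n := by
  have hn' : (0:ℝ) < n := by exact_mod_cast hn
  have h := intervalIntegral.integral_comp_add_div (a := 0) (b := π)
    (fun t => φ (x - t) * Real.cos (n * t - θ)) hn'.ne' (θ / n + k * (π / n))
  have e : ∀ v : ℝ, φ (x - (θ / n + k * (π / n) + v / n)) *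
      Real.cos (n * (θ / n + k * (π / n) + v / n) - θ)
      = (-1) ^ k * (φ (x - (θ / n + k * (π / n)) - v / n) * Real.cos v) := by
    intro v
    have : n * (θ / n + k * (π / n) + v / n) - θ = v + k * π := by field_simp; ring
    rw [this, Real.cos_add_nat_mul_pi, sub_sub]; ring
  simp only [e] at h
  have e2 : θ / n + k * (π / n) + π / n = θ / n + (k + 1 : ℕ) * (π / n) := by push_cast; ring
  rw [intervalIntegral.integral_const_mul, e2, zero_div, add_zero, smul_eq_mul] at h
  have hg : HM ω (fun s => φ (x - (θ / n + k * (π / n)) - s)) := by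
    intro t ht y h' hh
    have := hm t ht (x - (θ / n + k * (π / n)) - y) (-h') (by simpa using hh)
    have e : x - (θ / n + k * (π / n)) - y + -h' = x - (θ / n + k * (π / n)) - (y + h') := by ring
    rw [e] at this; exact this
  have h2 := half_wave hω (g := fun s => φ (x - (θ / n + k * (π / n)) - s)) (by fun_prop) hg hn
  rw [le_div_iff₀ hn', mul_comm, ← abs_of_pos hn', ← abs_mul, abs_of_pos hn', ← h, abs_mul]
  simpa using h2


def AP (n : ℕ) (f : ℝ → ℝ) (e : ℝ) : Prop := ∃ T, IsTrigPoly n T ∧ ∀ x, |f x - T x| ≤ e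

lemma AP.add {n : ℕ} {f g : ℝ → ℝ} {e e' : ℝ} (hf : AP n f e) (hg : AP n g e') :
    AP n (fun x => f x + g x) (e + e') := by
  obtain ⟨S, hS, h1⟩ := hf
  obtain ⟨T, hT, h2⟩ := hg
  refine ⟨_, hS.add hT, fun x => ?_⟩
  have : f x + g x - (S x + T x) = (f x - S x) + (g x - T x) := by ring
  rw [this]
  exact (abs_add_le _ _).trans (add_le_add (h1 x) (h2 x))

lemma AP.smul {n : ℕ} {f : ℝ → ℝ} {e : ℝ} (r : ℝ) (hf : AP n f e) :
    AP n (fun x => r * f x) (|r| * e) := by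
  obtain ⟨S, hS, h1⟩ := hf
  refine ⟨_, hS.smul r, fun x => ?_⟩
  rw [← mul_sub, abs_mul]
  exact mul_le_mul_of_nonneg_left (h1 x) (abs_nonneg r)

lemma IsTrigPoly.ap {n : ℕ} {f : ℝ → ℝ} (hf : IsTrigPoly n f) : AP n f 0 :=
  ⟨f, hf, fun x => by simp⟩

lemma AP.mono {n : ℕ} {f : ℝ → ℝ} {e e' : ℝ} (hf : AP n f e) (h : e ≤ e') : AP n f e' := by
  obtain ⟨S, hS, h1⟩ := hf
  exact ⟨S, hS, fun x => (h1 x).trans h⟩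

lemma AP.sum {ι : Type*} {n : ℕ} (s : Finset ι) {f : ι → ℝ → ℝ} {e : ι → ℝ}
    (h : ∀ i ∈ s, AP n (f i) (e i)) : AP n (fun x => ∑ i ∈ s, f i x) (∑ i ∈ s, e i) := by
  classical
  induction s using Finset.induction_on with
  | empty => simpa using (IsTrigPoly.zero n).ap
  | insert i s hi ih =>
    simp only [Finset.sum_insert hi]
    exact (h i (Finset.mem_insert_self _ _)).add
      (ih fun j hj => h j (Finset.mem_insert_of_mem hj))

def mainOp (φ : ℝ → ℝ) (θ : ℝ) (n m : ℕ) (x : ℝ) : ℝ :=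
  (1 / π) * ∫ t in (-π)..π, φ (x - t) * (Real.cos (n * t - θ) * KK m t)

lemma main_crude {ω φ : ℝ → ℝ} (hω : IsModulus ω) (hφ : Continuous φ)
    (hp : Function.Periodic φ (2 * π)) (hm : HM ω φ) {n : ℕ} (hn : 1 ≤ n) (θ : ℝ) (m : ℕ) :
    AP n (mainOp φ θ n m) (54 * ω (1 / n) * (m + 1)) := by
  obtain ⟨T, hT, hTx⟩ := jackson hω hφ hp hm hn
  have c1 := KK_cont m
  have c2 := hT.continuous
  have hpi := Real.pi_pos
  refine ⟨fun x => (1 / π) * ∫ t in (-π)..π, T (x - t) * (Real.cos (n * t - θ) * KK m t),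
    (hT.conv (by fun_prop) _ _).smul _, fun x => ?_⟩
  unfold mainOp
  rw [← mul_sub, ← intervalIntegral.integral_sub, abs_mul, abs_of_pos (by positivity)]
  · have h : |∫ t in (-π)..π, (φ (x - t) * (Real.cos (n * t - θ) * KK m t)
        - T (x - t) * (Real.cos (n * t - θ) * KK m t))| ≤ ∫ t in (-π)..π, 27 * ω (1 / n) * KK m t := by
      rw [← Real.norm_eq_abs]
      apply intervalIntegral.norm_integral_le_of_norm_le (by linarith)
      · refine Eventually.of_forall fun t _ => ?_
        rw [← sub_mul, norm_mul, norm_mul, Real.norm_eq_abs, Real.norm_eq_abs, Real.norm_eq_abs,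
          abs_of_nonneg (KK_nonneg m t)]
        have h1 := hTx (x - t)
        have h2 := Real.abs_cos_le_one (n * t - θ)
        exact mul_le_mul h1 (mul_le_of_le_one_left (KK_nonneg m t) h2)
          (mul_nonneg (abs_nonneg _) (KK_nonneg m t)) ((abs_nonneg _).trans h1)
      · apply Continuous.intervalIntegrable; fun_prop
    rw [intervalIntegral.integral_const_mul, KK_int] at h
    rw [one_div, inv_mul_le_iff₀ hpi]
    refine h.trans (le_of_eq ?_); ring
  · apply Continuous.intervalIntegrable; fun_prop
  · apply Continuous.intervalIntegrable; fun_prop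

lemma cells {F : ℝ → ℝ} (hF : Continuous F) (hp : Function.Periodic F (2 * π)) {n : ℕ}
    (hn : 1 ≤ n) (θ : ℝ) :
    ∫ t in (-π)..π, F t = ∑ k ∈ Finset.range (2 * n),
      ∫ t in (θ / n + k * (π / n))..(θ / n + (k + 1 : ℕ) * (π / n)), F t := by
  have hn' : (0:ℝ) < n := by exact_mod_cast hn
  rw [intervalIntegral.sum_integral_adjacent_intervals
    (a := fun k : ℕ => θ / n + k * (π / n)) (fun k _ => hF.intervalIntegrable _ _)]
  have := hp.intervalIntegral_add_eq (-π) (θ / n)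
  have e1 : -π + 2 * π = π := by ring
  have e2 : θ / n + (2 * n : ℕ) * (π / n) = θ / n + 2 * π := by push_cast; field_simp
  rw [e1] at this
  rw [e2, this]; simp

lemma main_fine {ω φ : ℝ → ℝ} (hω : IsModulus ω) (hφ : Continuous φ)
    (hp : Function.Periodic φ (2 * π)) (hm : HM ω φ) {n : ℕ} (hn : 1 ≤ n) (θ : ℝ) (m : ℕ) :
    AP n (mainOp φ θ n m)
      (2 / π * eN n ω * (m + 1) + 108 * π * ω (1 / n) / n * (m * (m + 1))) := by
  obtain ⟨T, hT, hTx⟩ := jackson hω hφ hp hm hn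
  have hn' : (0:ℝ) < n := by exact_mod_cast hn
  have c1 := KK_cont m
  have c2 := hT.continuous
  have c3 := KKd_cont m
  have hpi := Real.pi_pos
  have hw : 0 ≤ ω (1 / n) := hω.2.2.2.2 _ (by positivity)
  set y : ℕ → ℝ := fun k => θ / n + k * (π / n) with hy
  set c : ℕ → ℝ := fun k => (1 / (y (k + 1) - y k)) * ∫ s in (y k)..(y (k + 1)), KK m s with hc
  have hyd : ∀ k, y (k + 1) - y k = π / n := by intro k; simp only [hy]; push_cast; ring
  have hπn : 0 < π / n := by positivity
  have hylt : ∀ k, y k < y (k + 1) := by intro k; linarith [hyd k]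
  refine ⟨fun x => (1 / π) * ∑ k ∈ Finset.range (2 * n), ∫ t in (y k)..(y (k + 1)),
    T (x - t) * (Real.cos (n * t - θ) * (KK m t - c k)),
    (IsTrigPoly.sum _ fun k _ => hT.conv (by fun_prop) _ _).smul _, fun x => ?_⟩
  have hcells : ∫ t in (-π)..π, φ (x - t) * (Real.cos (n * t - θ) * KK m t)
      = ∑ k ∈ Finset.range (2 * n), ∫ t in (y k)..(y (k + 1)),
        φ (x - t) * (Real.cos (n * t - θ) * KK m t) := by
    refine cells (by fun_prop) ?_ hn θ
    intro t
    have e1 : n * (t + 2 * π) - θ = n * t - θ + n * (2 * π) := by ring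
    simp only [KK_per m t, e1, Real.cos_add_nat_mul_two_pi]
    rw [← sub_sub, hp.sub_eq]
  have hck : ∀ k, 0 ≤ c k := by
    intro k
    simp only [hc]
    rw [hyd]
    exact mul_nonneg (by positivity)
      (intervalIntegral.integral_nonneg (hylt k).le fun t _ => KK_nonneg m t)
  have hcsum : ∑ k ∈ Finset.range (2 * n), c k = 2 * n * (m + 1) := by
    simp only [hc, hyd]
    rw [← Finset.mul_sum, ← cells c1 (KK_per m) hn θ, KK_int]
    field_simp
  have hdsum : ∑ k ∈ Finset.range (2 * n), ∫ t in (y k)..(y (k + 1)), |KKd m t|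
      ≤ 4 * π * (m * (m + 1)) := by
    have hper : Function.Periodic (fun t => |KKd m t|) (2 * π) := by
      intro t
      have h1 : KKd m (t + 2 * π) = KKd m t := by
        have h2 := (KK_deriv m (t + 2 * π)).comp_add_const t (2 * π)
        have h3 : (fun x => KK m (x + 2 * π)) = KK m := funext (KK_per m)
        rw [h3] at h2
        exact h2.unique (KK_deriv m t)
      simp only [h1]
    rw [← cells (by fun_prop) hper hn θ]
    exact KKd_int m
  have hcell : ∀ k ∈ Finset.range (2 * n),
      |(∫ t in (y k)..(y (k + 1)), φ (x - t) * (Real.cos (n * t - θ) * KK m t))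
        - ∫ t in (y k)..(y (k + 1)), T (x - t) * (Real.cos (n * t - θ) * (KK m t - c k))|
      ≤ eN n ω / n * c k
        + 27 * ω (1 / n) * (π / n) * ∫ t in (y k)..(y (k + 1)), |KKd m t| := by
    intro k _
    have e : (∫ t in (y k)..(y (k + 1)), φ (x - t) * (Real.cos (n * t - θ) * KK m t))
        - ∫ t in (y k)..(y (k + 1)), T (x - t) * (Real.cos (n * t - θ) * (KK m t - c k))
        = c k * (∫ t in (y k)..(y (k + 1)), φ (x - t) * Real.cos (n * t - θ))
          + ∫ t in (y k)..(y (k + 1)),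
            (φ (x - t) - T (x - t)) * (Real.cos (n * t - θ) * (KK m t - c k)) := by
      rw [← intervalIntegral.integral_const_mul, ← intervalIntegral.integral_sub,
        ← intervalIntegral.integral_add]
      · congr 1; ext t; ring
      all_goals apply Continuous.intervalIntegrable; fun_prop
    rw [e]
    refine (abs_add_le _ _).trans (add_le_add ?_ ?_)
    · rw [abs_mul, abs_of_nonneg (hck k), mul_comm]
      exact mul_le_mul_of_nonneg_right (cell_wave hω hφ hm hn x θ k) (hck k)
    · have h1 : |∫ t in (y k)..(y (k + 1)),
            (φ (x - t) - T (x - t)) * (Real.cos (n * t - θ) * (KK m t - c k))|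
          ≤ ∫ t in (y k)..(y (k + 1)), 27 * ω (1 / n) * |KK m t - c k| := by
        rw [← Real.norm_eq_abs]
        apply intervalIntegral.norm_integral_le_of_norm_le (hylt k).le
        · refine Eventually.of_forall fun t _ => ?_
          rw [norm_mul, norm_mul, Real.norm_eq_abs, Real.norm_eq_abs, Real.norm_eq_abs]
          have h1 := hTx (x - t)
          have h2 := Real.abs_cos_le_one (n * t - θ)
          exact mul_le_mul h1 (mul_le_of_le_one_left (abs_nonneg _) h2)
            (mul_nonneg (abs_nonneg _) (abs_nonneg _)) ((abs_nonneg _).trans h1)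
        · apply Continuous.intervalIntegrable; fun_prop
      rw [intervalIntegral.integral_const_mul] at h1
      have h2 := cell_osc m (hylt k)
      rw [← hyd k, mul_assoc]
      exact h1.trans (mul_le_mul_of_nonneg_left h2 (by positivity))
  unfold mainOp
  rw [hcells, ← mul_sub, ← Finset.sum_sub_distrib, abs_mul, abs_of_pos (by positivity),
    one_div, inv_mul_le_iff₀ hpi]
  refine (Finset.abs_sum_le_sum_abs _ _).trans ((Finset.sum_le_sum hcell).trans ?_)
  rw [Finset.sum_add_distrib, ← Finset.mul_sum, ← Finset.mul_sum, hcsum]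
  have h3 : 27 * ω (1 / n) * (π / n) * ∑ k ∈ Finset.range (2 * n), ∫ t in (y k)..(y (k + 1)), |KKd m t|
      ≤ 27 * ω (1 / n) * (π / n) * (4 * π * (m * (m + 1))) := by gcongr
  refine (add_le_add le_rfl h3).trans (le_of_eq ?_)
  field_simp
  ring


def Hk (φ : ℝ → ℝ) (θ : ℝ) (k : ℤ) (x : ℝ) : ℝ :=
  (1 / π) * ∫ t in (-π)..π, φ (x - t) * Real.cos (k * t - θ)

lemma Hk_trig {φ : ℝ → ℝ} (hφ : Continuous φ) (hp : Function.Periodic φ (2 * π)) (θ : ℝ)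
    {n : ℕ} {k : ℤ} (h : |k| < n) : IsTrigPoly n (Hk φ θ k) :=
  ((IsTrigPoly.cos_int h θ).conv' hφ hp).smul _

lemma Hk_neg (φ : ℝ → ℝ) (θ : ℝ) (k : ℤ) (x : ℝ) : Hk φ θ (-k) x = Hk φ (-θ) k x := by
  unfold Hk
  congr 2; ext t
  rw [← Real.cos_neg]; congr 2; push_cast; ring

lemma KK_cos (n m : ℕ) (θ t : ℝ) : Real.cos (n * t - θ) * KK m t
    = ∑ k ∈ Finset.range (m + 1), ∑ l ∈ Finset.range (m + 1),
      Real.cos (((n + (k - l) : ℤ) : ℝ) * t - θ) := by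
  have h1 : ∑ k ∈ Finset.range (m + 1), ∑ l ∈ Finset.range (m + 1),
      Real.sin (((k - l : ℤ) : ℝ) * t) = 0 := by
    have h2 : ∑ k ∈ Finset.range (m + 1), ∑ l ∈ Finset.range (m + 1),
        Real.sin (((k - l : ℤ) : ℝ) * t) = - ∑ k ∈ Finset.range (m + 1), ∑ l ∈ Finset.range (m + 1),
        Real.sin (((k - l : ℤ) : ℝ) * t) := by
      conv_lhs => rw [Finset.sum_comm]
      rw [← Finset.sum_neg_distrib]
      apply Finset.sum_congr rfl; intro k _
      rw [← Finset.sum_neg_distrib]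
      apply Finset.sum_congr rfl; intro l _
      rw [← Real.sin_neg]; congr 1; push_cast; ring
    linarith
  have h3 : ∀ k l : ℕ, Real.cos (((n + (k - l) : ℤ) : ℝ) * t - θ)
      = Real.cos (n * t - θ) * (1 * 1 * Real.cos (((k - l : ℤ) : ℝ) * t))
        - Real.sin (n * t - θ) * Real.sin (((k - l : ℤ) : ℝ) * t) := by
    intro k l
    have : ((n + (k - l) : ℤ) : ℝ) * t - θ = (n * t - θ) + ((k - l : ℤ) : ℝ) * t := by
      push_cast; ring
    rw [this, Real.cos_add]; ring
  simp_rw [h3, Finset.sum_sub_distrib, ← Finset.mul_sum]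
  rw [h1]
  unfold KK; rw [JJ_exp]
  simp only [one_mul, mul_zero, sub_zero]

lemma mainOp_eq {φ : ℝ → ℝ} (hφ : Continuous φ) (θ : ℝ) (n m : ℕ) (x : ℝ) :
    mainOp φ θ n m x = ∑ k ∈ Finset.range (m + 1), ∑ l ∈ Finset.range (m + 1),
      Hk φ θ (n + (k - l)) x := by
  unfold mainOp Hk
  simp_rw [KK_cos, Finset.mul_sum]
  rw [intervalIntegral.integral_finsetSum, Finset.mul_sum]
  · apply Finset.sum_congr rfl; intro k _
    rw [intervalIntegral.integral_finsetSum, Finset.mul_sum]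
    intro l _; apply Continuous.intervalIntegrable; fun_prop
  · intro l _; apply Continuous.intervalIntegrable; fun_prop

lemma comb (F : ℤ → ℝ) (M : ℕ) :
    ∑ k ∈ Finset.range M, ∑ l ∈ Finset.range M, F (k - l)
    = ∑ i ∈ Finset.range M, ∑ j ∈ Finset.range (i + 1), F j
      + ∑ i ∈ Finset.range M, ∑ j ∈ Finset.range i, F (-(j + 1)) := by
  induction M with
  | zero => simp
  | succ M ih =>
    rw [Finset.sum_range_succ]
    simp_rw [Finset.sum_range_succ _ M]
    rw [Finset.sum_add_distrib, ih]
    have e1 : ∑ k ∈ Finset.range M, F (k - M) = ∑ j ∈ Finset.range M, F (-(j + 1)) := by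
      rw [← Finset.sum_range_reflect]
      apply Finset.sum_congr rfl; intro j hj
      have := Finset.mem_range.1 hj
      congr 1; omega
    have e2 : ∑ l ∈ Finset.range M, F (M - l) + F (M - M) = ∑ j ∈ Finset.range M, F j + F M := by
      rw [← Finset.sum_range_succ (fun l : ℕ => F (M - l)), ← Finset.sum_range_succ (fun l : ℕ => F l),
        ← Finset.sum_range_reflect]
      apply Finset.sum_congr rfl; intro j hj
      have := Finset.mem_range.1 hj
      congr 1; omega
    rw [e1, e2]; ring

def tau (φ : ℝ → ℝ) (θ : ℝ) (n m : ℕ) (x : ℝ) : ℝ :=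
  ∑ i ∈ Finset.range (m + 1), ∑ j ∈ Finset.range (i + 1), Hk φ θ (n + j) x

lemma tent (F : ℕ → ℝ) (M p : ℕ) (h : p ≤ M) :
    ∑ i ∈ Finset.range p, ∑ j ∈ Finset.range (i + 1), F j
      = ∑ j ∈ Finset.range M, ((p - j : ℕ) : ℝ) * F j := by
  induction p with
  | zero => simp
  | succ k ih =>
    have e : ∑ j ∈ Finset.range M, ((k + 1 - j : ℕ) : ℝ) * F j
        = ∑ j ∈ Finset.range M, (((k - j : ℕ) : ℝ) * F j
          + if j ∈ Finset.range (k + 1) then F j else 0) := by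
      apply Finset.sum_congr rfl
      intro j _
      split_ifs with hj
      · have := Finset.mem_range.1 hj
        have : k + 1 - j = (k - j) + 1 := by omega
        rw [this]; push_cast; ring
      · have : ¬ j < k + 1 := fun h => hj (Finset.mem_range.2 h)
        have h1 : k + 1 - j = 0 := by omega
        have h2 : k - j = 0 := by omega
        rw [h1, h2]; simp
    rw [e, Finset.sum_add_distrib, ← ih (by omega), Finset.sum_ite_mem, Finset.sum_range_succ]
    have : Finset.range M ∩ Finset.range (k + 1) = Finset.range (k + 1) :=
      Finset.inter_eq_right.2 (Finset.range_subset_range.2 h)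
    rw [this]

/-- decomposition of `tau` modulo trigonometric polynomials -/
lemma tau_step {φ : ℝ → ℝ} (hφ : Continuous φ) (hp : Function.Periodic φ (2 * π)) {n : ℕ}
    (hn : 1 ≤ n) (θ : ℝ) (m : ℕ) :
    ∃ S, IsTrigPoly n S ∧ ∀ x, tau φ θ n m x = mainOp φ θ n m x + S x
      + (if 2 * n ≤ m then -1 * tau φ (-θ) n (m - 2 * n) x else 0) := by
  have key : ∀ x, tau φ θ n m x = mainOp φ θ n m x
      - ∑ i ∈ Finset.range (m + 1), ∑ j ∈ Finset.range i, Hk φ θ (n + -(j + 1)) x := by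
    intro x
    rw [mainOp_eq hφ, comb (fun k => Hk φ θ (n + k) x)]
    unfold tau; ring
  have htr : ∀ j : ℕ, j + 1 < 2 * n → IsTrigPoly n (Hk φ θ (n + -((j:ℤ) + 1))) := by
    intro j hj
    apply Hk_trig hφ hp
    rw [abs_lt]; omega
  by_cases h : 2 * n ≤ m
  · simp only [if_pos h]
    refine ⟨fun x => (-1) * (∑ i ∈ Finset.range (2 * n), ∑ j ∈ Finset.range i,
        Hk φ θ (n + -((j:ℤ) + 1)) x + ∑ i ∈ Finset.range (m - 2 * n + 1),
        ∑ j ∈ Finset.range (2 * n - 1), Hk φ θ (n + -((j:ℤ) + 1)) x), ?_, fun x => ?_⟩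
    · refine IsTrigPoly.smul _ (IsTrigPoly.add ?_ ?_)
      · refine IsTrigPoly.sum _ fun i hi => IsTrigPoly.sum _ fun j hj => htr j ?_
        have := Finset.mem_range.1 hi
        have := Finset.mem_range.1 hj
        omega
      · refine IsTrigPoly.sum _ fun i hi => IsTrigPoly.sum _ fun j hj => htr j ?_
        have := Finset.mem_range.1 hj
        omega
    · rw [key]
      have e : m + 1 = 2 * n + (m - 2 * n + 1) := by omega
      rw [e, Finset.sum_range_add]
      have e2 : ∀ i ∈ Finset.range (m - 2 * n + 1),
          ∑ j ∈ Finset.range (2 * n + i), Hk φ θ (n + -((j:ℤ) + 1)) x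
          = ∑ j ∈ Finset.range (2 * n - 1), Hk φ θ (n + -((j:ℤ) + 1)) x
            + ∑ j ∈ Finset.range (i + 1), Hk φ (-θ) (n + j) x := by
        intro i _
        have e3 : 2 * n + i = (2 * n - 1) + (i + 1) := by omega
        rw [e3, Finset.sum_range_add]
        congr 1
        apply Finset.sum_congr rfl; intro j _
        rw [← Hk_neg]; congr 1; omega
      rw [Finset.sum_congr rfl e2, Finset.sum_add_distrib]
      unfold tau; ring
  · simp only [if_neg h]
    refine ⟨fun x => (-1) * (∑ i ∈ Finset.range (m + 1), ∑ j ∈ Finset.range i,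
        Hk φ θ (n + -((j:ℤ) + 1)) x), ?_, fun x => ?_⟩
    · refine IsTrigPoly.smul _ (IsTrigPoly.sum _ fun i hi => IsTrigPoly.sum _ fun j hj => htr j ?_)
      have := Finset.mem_range.1 hi
      have := Finset.mem_range.1 hj
      omega
    · rw [key]; ring

lemma tau_ap {ω φ : ℝ → ℝ} (hω : IsModulus ω) (hφ : Continuous φ)
    (hp : Function.Periodic φ (2 * π)) (hm : HM ω φ) {n : ℕ} (hn : 1 ≤ n) (L : ℕ) :
    ∀ (m : ℕ) (θ : ℝ), m < 2 * n * L → AP n (tau φ θ n m)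
      (54 * ω (1 / n) * ∑ i ∈ Finset.range L, ((m + 1 - 2 * n * i : ℕ) : ℝ)) := by
  have hw : 0 ≤ ω (1 / n) := hω.2.2.2.2 _ (by positivity)
  induction L with
  | zero => intro m θ h; simp at h
  | succ L ih =>
    intro m θ h
    obtain ⟨S, hS, hSx⟩ := tau_step hφ hp hn θ m
    rw [funext hSx, Finset.sum_range_succ']
    have h1 := (main_crude hω hφ hp hm hn θ m).add hS.ap
    by_cases hc : 2 * n ≤ m
    · simp only [if_pos hc]
      have h2 := ih (m - 2 * n) (-θ) (by rw [mul_add] at h; omega)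
      refine (h1.add (h2.smul (-1))).mono (le_of_eq ?_)
      have e : ∀ i, m - 2 * n + 1 - 2 * n * i = m + 1 - 2 * n * (i + 1) := by
        intro i; rw [mul_add]; omega
      simp only [e]
      simp; ring
    · simp only [if_neg hc, add_zero]
      refine h1.mono ?_
      have : 0 ≤ 54 * ω (1 / n) * ∑ i ∈ Finset.range L, ((m + 1 - 2 * n * (i + 1) : ℕ) : ℝ) := by
        positivity
      rw [mul_add]
      simp only [mul_zero, Nat.sub_zero]
      push_cast
      linarith

lemma tau_fine {ω φ : ℝ → ℝ} (hω : IsModulus ω) (hφ : Continuous φ)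
    (hp : Function.Periodic φ (2 * π)) (hm : HM ω φ) {n : ℕ} (hn : 1 ≤ n) (L : ℕ)
    (m : ℕ) (θ : ℝ) (h : m < 2 * n * (L + 1)) : AP n (tau φ θ n m)
      ((2 / π * eN n ω * (m + 1) + 108 * π * ω (1 / n) / n * (m * (m + 1)))
      + 54 * ω (1 / n) * ∑ i ∈ Finset.range L, ((m + 1 - 2 * n * (i + 1) : ℕ) : ℝ)) := by
  have hw : 0 ≤ ω (1 / n) := hω.2.2.2.2 _ (by positivity)
  obtain ⟨S, hS, hSx⟩ := tau_step hφ hp hn θ m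
  rw [funext hSx]
  have h1 := (main_fine hω hφ hp hm hn θ m).add hS.ap
  by_cases hc : 2 * n ≤ m
  · simp only [if_pos hc]
    have h2 := tau_ap hω hφ hp hm hn L (m - 2 * n) (-θ) (by rw [mul_add] at h; omega)
    refine (h1.add (h2.smul (-1))).mono (le_of_eq ?_)
    have e : ∀ i, m - 2 * n + 1 - 2 * n * i = m + 1 - 2 * n * (i + 1) := by
      intro i; rw [mul_add]; omega
    simp only [e]
    simp
  · simp only [if_neg hc, add_zero]
    refine h1.mono ?_
    have : 0 ≤ 54 * ω (1 / n) * ∑ i ∈ Finset.range L, ((m + 1 - 2 * n * (i + 1) : ℕ) : ℝ) := by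
      positivity
    linarith


lemma setup {ψ η : ℝ → ℝ} (h : IsMInfPlus ψ η) {n : ℕ} (hn : 2 < (n:ℝ) / (η n - n)) :
    1 ≤ n ∧ ∀ t ≥ (n:ℝ), t < η t ∧ ψ (η t) = ψ t / 2 ∧ η t - t ≤ t / ((n:ℝ) / (η n - n)) := by
  have h1 : 1 ≤ n := by
    rcases Nat.eq_zero_or_pos n with rfl | h
    · norm_num at hn
    · exact h
  refine ⟨h1, fun t ht => ?_⟩
  obtain ⟨hpos, -, hconv, hlim, hη, hmono, -⟩ := h
  have h1' : (1:ℝ) ≤ n := by exact_mod_cast h1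
  have ht1 : 1 ≤ t := h1'.trans ht
  obtain ⟨a, b⟩ := hη t ht1
  refine ⟨a, b, ?_⟩
  have := hmono (show (n:ℝ) ∈ Set.Ici 1 from h1') (show t ∈ Set.Ici 1 from ht1) ht
  simp only at this
  have h3 : 0 < η t - t := by linarith
  rw [le_div_iff₀ (by linarith)]
  rw [le_div_iff₀ h3] at this
  linarith

lemma tailA {ψ η : ℝ → ℝ} (h : IsMInfPlus ψ η) {n : ℕ} (hn : 2 < (n:ℝ) / (η n - n)) (N : ℕ) :
    ∑ j ∈ Finset.range N, ψ (n + 1 + j) ≤ ψ (n + 1) * (4 + 4 * n / ((n:ℝ) / (η n - n) - 2)) := by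
  obtain ⟨h1, h2⟩ := setup h hn
  have h1' : (1:ℝ) ≤ n := by exact_mod_cast h1
  have hp : ∀ t ≥ (n:ℝ), 0 ≤ ψ t := fun t ht => (h.1 t (h1'.trans ht)).le
  have := tail_sum n _ hn h1' hp
    (fun s t hs hst => psi_anti h (show s ∈ Set.Ici 1 from h1'.trans hs)
      (show t ∈ Set.Ici 1 from h1'.trans (hs.trans hst)) hst) h2 1 one_pos N (n + 1) (by linarith)
  simp only [mul_one, div_one] at this
  refine this.trans ?_
  apply mul_le_mul_of_nonneg_left _ (hp _ (by linarith))
  set μ := (n:ℝ) / (η n - n)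
  have : 2 / (μ - 1) * (n + 1) ≤ 4 * n / (μ - 2) := by
    rw [div_mul_eq_mul_div, div_le_div_iff₀ (by linarith) (by linarith)]
    nlinarith
  linarith

lemma tailB {ψ η : ℝ → ℝ} (h : IsMInfPlus ψ η) {n : ℕ} (hn : 2 < (n:ℝ) / (η n - n)) (N : ℕ) :
    ∑ i ∈ Finset.range N, ψ (3 * n + i * (2 * n)) ≤ 7 * ψ (3 * n) := by
  obtain ⟨h1, h2⟩ := setup h hn
  have h1' : (1:ℝ) ≤ n := by exact_mod_cast h1
  have hp : ∀ t ≥ (n:ℝ), 0 ≤ ψ t := fun t ht => (h.1 t (h1'.trans ht)).le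
  have := tail_sum n _ hn h1' hp
    (fun s t hs hst => psi_anti h (show s ∈ Set.Ici 1 from h1'.trans hs)
      (show t ∈ Set.Ici 1 from h1'.trans (hs.trans hst)) hst) h2 (2 * n) (by linarith) N (3 * n)
      (by linarith)
  refine this.trans ?_
  rw [mul_comm]
  apply mul_le_mul_of_nonneg_right _ (hp _ (by linarith))
  set μ := (n:ℝ) / (η n - n)
  have e : (3 * (n:ℝ)) / (2 * n) = 3 / 2 := by field_simp
  have : 2 / (μ - 1) ≤ 2 := by
    rw [div_le_iff₀ (by linarith)]; linarith
  rw [e]; linarith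

lemma psi_summable {ψ η : ℝ → ℝ} (h : IsMInfPlus ψ η) {n : ℕ} (hn : 2 < (n:ℝ) / (η n - n)) :
    Summable (fun k : ℕ => ψ k) := by
  obtain ⟨h1, h2⟩ := setup h hn
  have h1' : (1:ℝ) ≤ n := by exact_mod_cast h1
  rw [← summable_nat_add_iff (n + 1)]
  have e : ∀ k : ℕ, ((k + (n + 1) : ℕ) : ℝ) = n + 1 + k := fun k => by push_cast; ring
  simp_rw [e]
  refine summable_of_sum_range_le (fun k => (h.1 _ ?_).le) (tailA h hn)
  have : (0:ℝ) ≤ k := Nat.cast_nonneg _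
  change (1:ℝ) ≤ _
  linarith

lemma per_bdd {φ : ℝ → ℝ} (hφ : Continuous φ) (hp : Function.Periodic φ (2 * π)) :
    ∃ C, 0 ≤ C ∧ ∀ x, |φ x| ≤ C := by
  obtain ⟨C, hC⟩ := (Function.Periodic.compact_of_continuous hp (by positivity) hφ).isBounded.exists_norm_le
  refine ⟨max C 0, le_max_right _ _, fun x => ?_⟩
  exact (hC (φ x) ⟨x, rfl⟩).trans (le_max_left _ _)

lemma Hk_bdd {φ : ℝ → ℝ} {C : ℝ} (hC : ∀ x, |φ x| ≤ C) (θ : ℝ) (k : ℤ) (x : ℝ) :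
    |Hk φ θ k x| ≤ 2 * C := by
  unfold Hk
  have h0 : 0 ≤ C := (abs_nonneg _).trans (hC 0)
  have : ‖∫ t in (-π)..π, φ (x - t) * Real.cos (k * t - θ)‖ ≤ C * |π - (-π)| := by
    apply intervalIntegral.norm_integral_le_of_norm_le_const
    intro t _
    rw [Real.norm_eq_abs, abs_mul]
    calc _ ≤ C * 1 := mul_le_mul (hC _) (Real.abs_cos_le_one _) (abs_nonneg _) h0
      _ = C := mul_one _
  rw [Real.norm_eq_abs] at this
  rw [abs_mul, abs_of_pos (by positivity : (0:ℝ) < 1 / π)]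
  have e : |π - (-π)| = 2 * π := by rw [abs_of_pos] <;> linarith [Real.pi_pos]
  rw [e] at this
  calc _ ≤ 1 / π * (C * (2 * π)) := mul_le_mul_of_nonneg_left this (by positivity)
    _ = 2 * C := by field_simp

lemma f_series {ψ : ℝ → ℝ} (hs : Summable (fun k : ℕ => ψ k)) {φ : ℝ → ℝ} (hφ : Continuous φ)
    (hp : Function.Periodic φ (2 * π)) (β x : ℝ) :
    HasSum (fun k : ℕ => ψ ((k + 1 : ℕ) : ℝ) * Hk φ (β * π / 2) ((k + 1 : ℕ) : ℤ) x)
      ((1 / π) * ∫ t in (-π)..π, φ (x - t) * PsiKer ψ β t) := by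
  obtain ⟨C, hC0, hC⟩ := per_bdd hφ hp
  have hs' : Summable (fun k : ℕ => ψ ((k + 1 : ℕ) : ℝ)) := (summable_nat_add_iff 1).2 hs
  have hb : ∀ (k : ℕ) (t : ℝ),
      ‖φ (x - t) * (ψ ((k + 1 : ℕ) : ℝ) * Real.cos (((k + 1 : ℕ) : ℝ) * t - β * π / 2))‖
      ≤ C * ‖ψ ((k + 1 : ℕ) : ℝ)‖ := by
    intro k t
    rw [norm_mul, norm_mul]
    apply mul_le_mul (hC _) _ (by positivity) hC0
    exact mul_le_of_le_one_right (norm_nonneg _) (Real.abs_cos_le_one _)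
  have := intervalIntegral.hasSum_integral_of_dominated_convergence (μ := volume) (a := -π) (b := π)
    (F := fun (k : ℕ) t =>
      φ (x - t) * (ψ ((k + 1 : ℕ) : ℝ) * Real.cos (((k + 1 : ℕ) : ℝ) * t - β * π / 2)))
    (f := fun t => φ (x - t) * PsiKer ψ β t)
    (fun k _ => C * ‖ψ ((k + 1 : ℕ) : ℝ)‖)
    (fun k => (by fun_prop : Continuous _).aestronglyMeasurable)
    (fun k => ae_of_all _ fun t _ => hb k t)
    (ae_of_all _ fun t _ => hs'.norm.mul_left C)
    (by simp)
    (ae_of_all _ fun t _ => by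
      have h1 : Summable (fun k : ℕ => ψ ((k + 1 : ℕ) : ℝ) * Real.cos (((k + 1 : ℕ) : ℝ) * t - β * π / 2)) := by
        refine Summable.of_norm_bounded hs'.norm fun k => ?_
        rw [norm_mul]
        exact mul_le_of_le_one_right (norm_nonneg _) (Real.abs_cos_le_one _)
      have := h1.hasSum.mul_left (φ (x - t))
      unfold PsiKer
      simpa using this)
  have e : (fun k : ℕ => ψ ((k + 1 : ℕ) : ℝ) * Hk φ (β * π / 2) ((k + 1 : ℕ) : ℤ) x)
      = fun k : ℕ => 1 / π * ∫ t in (-π)..π,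
      φ (x - t) * (ψ ((k + 1 : ℕ) : ℝ) * Real.cos (((k + 1 : ℕ) : ℝ) * t - β * π / 2)) := by
    ext k
    unfold Hk
    rw [mul_left_comm, ← intervalIntegral.integral_const_mul]
    congr 2; ext t
    push_cast
    ring
  rw [e]
  exact this.mul_left (1 / π)

lemma sum_tau (a : ℕ → ℝ) (φ : ℝ → ℝ) (θ : ℝ) (n M : ℕ) (x : ℝ) :
    ∑ m ∈ Finset.range M, dd a m * tau φ θ n m x
      = ∑ j ∈ Finset.range M, aM a M j * Hk φ θ (n + j) x := by
  unfold aM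
  simp_rw [Finset.sum_mul]
  rw [Finset.sum_comm]
  apply Finset.sum_congr rfl
  intro m hm
  unfold tau
  rw [tent (fun j => Hk φ θ (n + j) x) M (m + 1) (by simpa using hm), Finset.mul_sum]
  apply Finset.sum_congr rfl
  intro j _
  ring

lemma aseq {ψ η : ℝ → ℝ} (h : IsMInfPlus ψ η) {n : ℕ} (hn : 1 ≤ n) :
    (∀ m, 0 ≤ dd (fun j : ℕ => ψ ((n + j : ℕ) : ℝ)) m) ∧ (∀ j : ℕ, 0 ≤ ψ ((n + j : ℕ) : ℝ)) ∧
    Antitone (fun j : ℕ => ψ ((n + j : ℕ) : ℝ)) ∧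
    Tendsto (fun j : ℕ => ψ ((n + j : ℕ) : ℝ)) atTop (nhds 0) := by
  have h1 : ∀ j : ℕ, (1:ℝ) ≤ ((n + j : ℕ) : ℝ) := fun j => by exact_mod_cast (by omega : 1 ≤ n + j)
  refine ⟨fun m => ?_, fun j => (h.1 _ (h1 j)).le, fun i j hij => ?_, ?_⟩
  · unfold dd
    have := h.2.2.1.2 (show _ ∈ Set.Ici (1:ℝ) from h1 m) (show _ ∈ Set.Ici (1:ℝ) from h1 (m + 2))
      (by norm_num : (0:ℝ) ≤ 1 / 2) (by norm_num : (0:ℝ) ≤ 1 / 2) (by norm_num)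
    have e : (1 / 2 : ℝ) • ((n + m : ℕ) : ℝ) + (1 / 2 : ℝ) • ((n + (m + 2) : ℕ) : ℝ)
        = ((n + (m + 1) : ℕ) : ℝ) := by
      simp only [smul_eq_mul]; push_cast; ring
    rw [e] at this
    simp only [smul_eq_mul] at this
    linarith
  · exact psi_anti h (show _ ∈ Set.Ici (1:ℝ) from h1 i) (show _ ∈ Set.Ici (1:ℝ) from h1 j)
      (by exact_mod_cast (by omega : n + i ≤ n + j))
  · refine h.2.2.2.1.comp (tendsto_natCast_atTop_atTop.comp ?_)
    exact tendsto_atTop_mono (fun j => by omega : ∀ j, j ≤ n + j) tendsto_id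

lemma upper_M {ψ η ω φ : ℝ → ℝ} (h : IsMInfPlus ψ η) {n : ℕ} (hn : 2 < (n:ℝ) / (η n - n))
    (hω : IsModulus ω) (hφ : Continuous φ)
    (hp : Function.Periodic φ (2 * π)) (hm : HM ω φ) (θ : ℝ) (M : ℕ) :
    AP n (fun x => ∑ m ∈ Finset.range M, dd (fun j : ℕ => ψ ((n + j : ℕ) : ℝ)) m * tau φ θ n m x)
      ((2 / π) * ψ n * eN n ω + 3000 * gammaN ψ η n * ω (1 / n)) := by
  obtain ⟨h1, h2⟩ := setup h hn
  have h1' : (1:ℝ) ≤ n := by exact_mod_cast h1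
  obtain ⟨hd, h0, ha, hl⟩ := aseq h h1
  set a := fun j : ℕ => ψ ((n + j : ℕ) : ℝ) with hadef
  have hw : 0 ≤ ω (1 / n) := hω.2.2.2.2 _ (by positivity)
  have he := eN_nonneg hω n
  refine (AP.sum _ fun m hm' => (tau_fine hω hφ hp hm h1 M m θ ?_).smul (dd a m)).mono ?_
  · have := Finset.mem_range.1 hm'
    nlinarith
  have e1 : ∑ m ∈ Finset.range M, |dd a m| * ((2/π*eN n ω*(m+1) + 108*π*ω (1/n)/n*(m*(m+1)))
        + 54*ω (1/n) * ∑ i ∈ Finset.range M, ((m+1-2*n*(i+1):ℕ):ℝ))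
      = 2/π*eN n ω * aM a M 0 + 108*π*ω (1/n)/n * (2 * ∑ j ∈ Finset.range M, aM a M (j + 1))
        + 54*ω (1/n) * ∑ i ∈ Finset.range M, aM a M (2*n*(i+1)) := by
    rw [← aM_sum]
    unfold aM
    rw [Finset.sum_comm]
    simp_rw [Finset.mul_sum]
    rw [← Finset.sum_add_distrib, ← Finset.sum_add_distrib]
    apply Finset.sum_congr rfl
    intro m _
    rw [abs_of_nonneg (hd m), mul_add, mul_add, Finset.mul_sum]
    congr 1
    · push_cast
      ring_nf
    · apply Finset.sum_congr rfl
      intro i _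
      ring
  rw [e1]
  have b1 : aM a M 0 ≤ ψ n := by simpa [hadef] using aM_le h0 ha M 0
  have b2 : ∑ j ∈ Finset.range M, aM a M (j + 1)
      ≤ ψ (n + 1) * (4 + 4 * n / ((n:ℝ) / (η n - n) - 2)) := by
    refine le_trans (Finset.sum_le_sum fun j _ => ?_) (tailA h hn M)
    refine (aM_le h0 ha M (j + 1)).trans (le_of_eq ?_)
    congr 1; push_cast; ring
  have b3 : ∑ i ∈ Finset.range M, aM a M (2*n*(i+1)) ≤ 7 * ψ (3 * n) := by
    refine le_trans (Finset.sum_le_sum fun j _ => ?_) (tailB h hn M)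
    refine (aM_le h0 ha M _).trans (le_of_eq ?_)
    congr 1; push_cast; ring
  have p1 : 0 < ψ (n + 1) := h.1 _ (by change (1:ℝ) ≤ _; linarith)
  have p3 : 0 < ψ (3 * n) := h.1 _ (by change (1:ℝ) ≤ _; linarith)
  unfold gammaN
  set μ := (n:ℝ) / (η n - n)
  have hL : 0 ≤ max 0 (Real.log (η n - n)) := le_max_left _ _
  set Lg := max 0 (Real.log (η n - n))
  have c1 : 2/π*eN n ω * aM a M 0 ≤ 2 / π * ψ n * eN n ω := by
    calc _ ≤ 2/π*eN n ω * ψ n := mul_le_mul_of_nonneg_left b1 (by positivity)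
      _ = _ := by ring
  have hμ : 0 < μ - 2 := by linarith
  have c2 : 108*π*ω (1/n)/n * (2 * ∑ j ∈ Finset.range M, aM a M (j + 1))
      ≤ 864 * π * (ψ (n + 1) * (1 / n + 1 / (μ - 2)) * ω (1 / n)) := by
    calc _ ≤ 108*π*ω (1/n)/n * (2 * (ψ (n + 1) * (4 + 4 * n / (μ - 2)))) := by
          apply mul_le_mul_of_nonneg_left _ (by positivity)
          linarith
      _ = 864 * π * (ψ (n + 1) * (1 / n + 1 / (μ - 2)) * ω (1 / n)) := by
          field_simp; ring
  have c3 : 54*ω (1/n) * ∑ i ∈ Finset.range M, aM a M (2*n*(i+1)) ≤ 378 * (ψ (3 * n) * ω (1 / n)) := by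
    calc _ ≤ 54*ω (1/n) * (7 * ψ (3 * n)) := mul_le_mul_of_nonneg_left b3 (by positivity)
      _ = _ := by ring
  have q1 : 0 ≤ ψ (n + 1) * (1 / n + 1 / (μ - 2)) * ω (1 / n) := by positivity
  have q2 : 0 ≤ ψ (3 * n) * ω (1 / n) := by positivity
  have q3 : 0 ≤ ψ (3 * n) * Lg * ω (1 / n) := by positivity
  have c4 : 864 * π * (ψ (n + 1) * (1 / n + 1 / (μ - 2)) * ω (1 / n))
      ≤ 3000 * (ψ (n + 1) * (1 / n + 1 / (μ - 2)) * ω (1 / n)) := by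
    apply mul_le_mul_of_nonneg_right _ q1
    linarith [Real.pi_lt_d2]
  have e5 : 3000 * (ψ (n + 1) * (1 / n + 1 / (μ - 2)) + ψ (3 * n) * (1 + Lg)) * ω (1 / n)
      = 3000 * (ψ (n + 1) * (1 / n + 1 / (μ - 2)) * ω (1 / n)) + 3000 * (ψ (3 * n) * ω (1 / n))
        + 3000 * (ψ (3 * n) * Lg * ω (1 / n)) := by ring
  rw [e5]
  linarith

lemma upper_f {ψ η ω f : ℝ → ℝ} (h : IsMInfPlus ψ η) {n : ℕ} (hn : 2 < (n:ℝ) / (η n - n))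
    (hω : IsModulus ω) (β : ℝ) (hf : f ∈ CClass ψ β ω) {ε : ℝ} (hε : 0 < ε) :
    AP n f ((2 / π) * ψ n * eN n ω + 3000 * gammaN ψ η n * ω (1 / n) + ε) := by
  obtain ⟨-, -, a₀, φ, hφ, hp, -, hm, hfx⟩ := hf
  obtain ⟨h1, h2⟩ := setup h hn
  obtain ⟨hd, h0, ha, hl⟩ := aseq h h1
  have hs := psi_summable h hn
  obtain ⟨C, hC0, hC⟩ := per_bdd hφ hp
  have hsa : Summable (fun j : ℕ => ψ ((n + j : ℕ) : ℝ)) := by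
    have := (summable_nat_add_iff n).2 hs
    simpa [add_comm] using this
  set θ := β * π / 2 with hθ
  set a := fun j : ℕ => ψ ((n + j : ℕ) : ℝ) with hadef
  -- tail vanishing
  have htail : Tendsto (fun M => ∑' j, (a j - aM a M j)) atTop (nhds (∑' j : ℕ, (0:ℝ))) := by
    refine tendsto_tsum_of_dominated_convergence (bound := a) hsa (fun j => ?_)
      (Eventually.of_forall fun M j => ?_)
    · simpa using (aM_tendsto hd h0 ha hl j).const_sub (a j)
    · rw [Real.norm_eq_abs, abs_of_nonneg (sub_nonneg.2 (aM_le h0 ha M j))]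
      linarith [aM_nonneg hd M j]
  rw [tsum_zero] at htail
  have hev := (htail.const_mul (2 * C)).eventually (gt_mem_nhds (by simpa using hε : 2 * C * 0 < ε))
  obtain ⟨M, hM⟩ := hev.exists
  have hzero : ∀ j, M ≤ j → aM a M j = 0 := by
    intro j hj
    unfold aM
    apply Finset.sum_eq_zero
    intro m hm'
    have : m + 1 - j = 0 := by have := Finset.mem_range.1 hm'; omega
    simp [this]
  have hsm : Summable (fun j => aM a M j) :=
    summable_of_ne_finset_zero (s := Finset.range M) fun j hj => hzero j (by simpa using hj)
  have hrep : ∀ x, f x = (a₀ / 2 + ∑ k ∈ Finset.range (n - 1),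
      ψ ((k + 1 : ℕ) : ℝ) * Hk φ θ ((k + 1 : ℕ) : ℤ) x) + ∑' j, a j * Hk φ θ (n + j) x := by
    intro x
    have hs1 := f_series hs hφ hp β x
    rw [hfx x, ← hs1.tsum_eq, ← hs1.summable.sum_add_tsum_nat_add (n - 1), add_assoc]
    congr 3
    ext j
    have e : j + (n - 1) + 1 = n + j := by omega
    simp only [hadef, e]
    congr 2
  have hbd : ∀ j x, |a j * Hk φ θ (n + j) x| ≤ 2 * C * a j := by
    intro j x
    rw [abs_mul, abs_of_nonneg (h0 j), mul_comm]
    exact mul_le_mul_of_nonneg_right (Hk_bdd hC _ _ _) (h0 j)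
  have hbd' : ∀ j x, |(a j - aM a M j) * Hk φ θ (n + j) x| ≤ 2 * C * (a j - aM a M j) := by
    intro j x
    have := sub_nonneg.2 (aM_le h0 ha M j)
    rw [abs_mul, abs_of_nonneg this, mul_comm]
    exact mul_le_mul_of_nonneg_right (Hk_bdd hC _ _ _) this
  have hT : IsTrigPoly n (fun x => a₀ / 2 + ∑ k ∈ Finset.range (n - 1),
      ψ ((k + 1 : ℕ) : ℝ) * Hk φ θ ((k + 1 : ℕ) : ℤ) x) := by
    refine (IsTrigPoly.const h1 _).add (IsTrigPoly.sum _ fun k hk => (Hk_trig hφ hp θ ?_).smul _)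
    have := Finset.mem_range.1 hk
    rw [abs_of_nonneg (by positivity)]
    omega
  obtain ⟨S, hS, hSx⟩ := upper_M h hn hω hφ hp hm θ M
  refine ⟨_, hT.add hS, fun x => ?_⟩
  have hsx : |∑ m ∈ Finset.range M, dd a m * tau φ θ n m x - S x| ≤ _ := hSx x
  rw [sum_tau] at hsx
  have hfin : ∑ j ∈ Finset.range M, aM a M j * Hk φ θ (n + j) x = ∑' j, aM a M j * Hk φ θ (n + j) x := by
    symm
    apply tsum_eq_sum
    intro j hj
    rw [hzero j (by simpa using hj), zero_mul]
  have hS1 : Summable (fun j : ℕ => a j * Hk φ θ (n + j) x) :=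
    Summable.of_norm_bounded (hsa.mul_left (2 * C)) fun j => hbd j x
  have hS2 : Summable (fun j : ℕ => aM a M j * Hk φ θ (n + j) x) :=
    summable_of_ne_finset_zero (s := Finset.range M) fun j hj => by
      rw [hzero j (by simpa using hj), zero_mul]
  have hdiff : |∑' j, a j * Hk φ θ (n + j) x - ∑' j, aM a M j * Hk φ θ (n + j) x| ≤ ε := by
    rw [← hS1.tsum_sub hS2]
    have e : ∀ j : ℕ, a j * Hk φ θ (n + j) x - aM a M j * Hk φ θ (n + j) x
      = (a j - aM a M j) * Hk φ θ (n + j) x := fun j => by ring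
    simp_rw [e]
    have := tsum_of_norm_bounded (f := fun j : ℕ => (a j - aM a M j) * Hk φ θ (n + j) x) (((hsa.sub hsm).mul_left (2 * C)).hasSum) (fun j => hbd' j x)
    rw [Real.norm_eq_abs, tsum_mul_left] at this
    exact this.trans hM.le
  rw [hrep x]
  rw [hfin] at hsx
  rw [abs_le] at *
  constructor <;> linarith [hsx.1, hsx.2, hdiff.1, hdiff.2]

lemma EnC_set_nonempty (n : ℕ) (f : ℝ → ℝ) :
    {e | ∃ T : ℝ → ℝ, IsTrigPoly n T ∧ e = ⨆ x : ℝ, |f x - T x|}.Nonempty :=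
  ⟨_, _, IsTrigPoly.zero n, rfl⟩

lemma EnC_le {n : ℕ} {f : ℝ → ℝ} {e : ℝ} (h : AP n f e) : EnC n f ≤ e := by
  obtain ⟨T, hT, hx⟩ := h
  refine le_trans (csInf_le ⟨0, ?_⟩ ⟨T, hT, rfl⟩ : EnC n f ≤ ⨆ x : ℝ, |f x - T x|) (ciSup_le hx)
  rintro _ ⟨T, -, rfl⟩
  exact Real.iSup_nonneg fun x => abs_nonneg _

lemma EnC_upper {ψ η ω f : ℝ → ℝ} (h : IsMInfPlus ψ η) {n : ℕ} (hn : 2 < (n:ℝ) / (η n - n))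
    (hω : IsModulus ω) (β : ℝ) (hf : f ∈ CClass ψ β ω) :
    EnC n f ≤ (2 / π) * ψ n * eN n ω + 3000 * gammaN ψ η n * ω (1 / n) :=
  le_of_forall_pos_le_add fun _ hε => EnC_le (upper_f h hn hω β hf hε)


lemma asin_sin_lip (a b : ℝ) :
    |Real.arcsin (Real.sin a) - Real.arcsin (Real.sin b)| ≤ |a - b| := by
  set p := Real.arcsin (Real.sin a) with hp
  set r := Real.arcsin (Real.sin b) with hr
  have p1 := Real.arcsin_le_pi_div_two (Real.sin a)
  have p2 := Real.neg_pi_div_two_le_arcsin (Real.sin a)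
  have r1 := Real.arcsin_le_pi_div_two (Real.sin b)
  have r2 := Real.neg_pi_div_two_le_arcsin (Real.sin b)
  rw [← hp] at p1 p2
  rw [← hr] at r1 r2
  have hpr : |p - r| ≤ π := abs_le.2 ⟨by linarith, by linarith⟩
  by_contra hcon
  push Not at hcon
  have h1 : Real.cos |p - r| < Real.cos |a - b| :=
    Real.strictAntiOn_cos ⟨abs_nonneg _, by linarith⟩ ⟨abs_nonneg _, hpr⟩ hcon
  rw [Real.cos_abs, Real.cos_abs, Real.cos_sub, Real.cos_sub] at h1
  have s1 : Real.sin p = Real.sin a := Real.sin_arcsin (Real.neg_one_le_sin _) (Real.sin_le_one _)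
  have s2 : Real.sin r = Real.sin b := Real.sin_arcsin (Real.neg_one_le_sin _) (Real.sin_le_one _)
  have c1 : Real.cos p = |Real.cos a| := by
    rw [hp, Real.cos_arcsin, Real.abs_cos_eq_sqrt_one_sub_sin_sq]
  have c2 : Real.cos r = |Real.cos b| := by
    rw [hr, Real.cos_arcsin, Real.abs_cos_eq_sqrt_one_sub_sin_sq]
  rw [s1, s2, c1, c2, ← abs_mul] at h1
  linarith [le_abs_self (Real.cos a * Real.cos b)]

def Sf (ω : ℝ → ℝ) (y : ℝ) : ℝ := if 0 ≤ y then ω (2 * y) / 3 else - (ω (-(2 * y)) / 3)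

lemma Sf_neg {ω : ℝ → ℝ} (hω : IsModulus ω) (y : ℝ) : Sf ω (-y) = - Sf ω y := by
  have h0 := hω.2.2.2.1
  unfold Sf
  rcases lt_trichotomy y 0 with h | h | h
  · rw [if_pos (by linarith), if_neg (by linarith)]; simp
  · subst h; simp [h0]
  · rw [if_neg (by linarith), if_pos (by linarith)]; simp

lemma Sf_same {ω : ℝ → ℝ} (hω : IsModulus ω) {y z : ℝ} (hz : 0 ≤ z) (hyz : z ≤ y) :
    |Sf ω y - Sf ω z| ≤ ω (|y - z|) := by
  obtain ⟨-, hmono, hsub, h0, hnn⟩ := hω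
  unfold Sf
  rw [if_pos hz, if_pos (hz.trans hyz), abs_of_nonneg (sub_nonneg.2 hyz)]
  have a1 := hmono (show 2 * z ∈ Set.Ici (0:ℝ) from by simpa using hz)
    (show 2 * y ∈ Set.Ici (0:ℝ) from by simpa using hz.trans hyz) (by linarith)
  have a2 := hsub (2 * z) (2 * (y - z)) (by linarith) (by linarith)
  have a3 := hsub (y - z) (y - z) (by linarith) (by linarith)
  have e2 : 2 * z + 2 * (y - z) = 2 * y := by ring
  have e3 : (y - z) + (y - z) = 2 * (y - z) := by ring
  rw [e2] at a2; rw [e3] at a3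
  have := hnn (y - z) (by linarith)
  rw [abs_of_nonneg (by linarith)]
  linarith

lemma Sf_opp {ω : ℝ → ℝ} (hω : IsModulus ω) {y z : ℝ} (hz : 0 ≤ z) (hyz : z ≤ y) :
    |Sf ω y + Sf ω z| ≤ ω (|y + z|) := by
  obtain ⟨-, hmono, hsub, h0, hnn⟩ := hω
  unfold Sf
  rw [if_pos hz, if_pos (hz.trans hyz), abs_of_nonneg (by linarith : 0 ≤ y + z)]
  have a1 := hmono (show 2 * z ∈ Set.Ici (0:ℝ) from by simpa using hz)
    (show y + z ∈ Set.Ici (0:ℝ) from by change 0 ≤ y + z; linarith) (by linarith)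
  have a2 := hsub (y + z) (y - z) (by linarith) (by linarith)
  have a3 := hmono (show y - z ∈ Set.Ici (0:ℝ) from by change 0 ≤ y - z; linarith)
    (show y + z ∈ Set.Ici (0:ℝ) from by change 0 ≤ y + z; linarith) (by linarith)
  have e2 : y + z + (y - z) = 2 * y := by ring
  rw [e2] at a2
  have := hnn (2 * y) (by linarith)
  have := hnn (2 * z) (by linarith)
  rw [abs_of_nonneg (by linarith)]
  linarith

lemma Sf_lip {ω : ℝ → ℝ} (hω : IsModulus ω) (y z : ℝ) : |Sf ω y - Sf ω z| ≤ ω (|y - z|) := by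
  have key : ∀ y z : ℝ, 0 ≤ y → |z| ≤ y → |Sf ω y - Sf ω z| ≤ ω (|y - z|) := by
    intro y z hy hz
    rcases le_total 0 z with h | h
    · exact Sf_same hω h (by rwa [abs_of_nonneg h] at hz)
    · have := Sf_opp hω (neg_nonneg.2 h) (by rwa [abs_of_nonpos h] at hz : -z ≤ y)
      rw [Sf_neg hω] at this
      simpa [sub_eq_add_neg] using this
  have key2 : ∀ y z : ℝ, |z| ≤ |y| → |Sf ω y - Sf ω z| ≤ ω (|y - z|) := by
    intro y z h
    rcases le_total 0 y with hy | hy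
    · exact key y z hy (by rwa [abs_of_nonneg hy] at h)
    · have := key (-y) (-z) (neg_nonneg.2 hy) (by rwa [abs_neg, ← abs_of_nonpos hy])
      rw [Sf_neg hω, Sf_neg hω] at this
      rw [← abs_neg (y - z), ← abs_neg (Sf ω y - Sf ω z)]
      convert this using 2
      · ring
      · congr 1; ring
  rcases le_total |z| |y| with h | h
  · exact key2 y z h
  · rw [abs_sub_comm, abs_sub_comm y z]; exact key2 z y h

def Ph (ω : ℝ → ℝ) (n : ℕ) (x : ℝ) : ℝ := Sf ω (Real.arcsin (Real.sin (n * x)) / n)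

lemma Ph_lip {ω : ℝ → ℝ} (hω : IsModulus ω) {n : ℕ} (hn : 1 ≤ n) (x y : ℝ) :
    |Ph ω n x - Ph ω n y| ≤ ω |x - y| := by
  have hn' : (0:ℝ) < n := by exact_mod_cast hn
  refine (Sf_lip hω _ _).trans (hω.2.1 (Set.mem_Ici.2 (abs_nonneg _)) (Set.mem_Ici.2 (abs_nonneg _)) ?_)
  rw [← sub_div, abs_div, abs_of_pos hn', div_le_iff₀ hn']
  refine (asin_sin_lip _ _).trans (le_of_eq ?_)
  rw [← mul_sub, abs_mul, abs_of_pos hn', mul_comm]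

lemma Ph_HM {ω : ℝ → ℝ} (hω : IsModulus ω) {n : ℕ} (hn : 1 ≤ n) : HM ω (Ph ω n) := by
  intro t ht x h hh
  refine (Ph_lip hω hn _ _).trans (hω.2.1 (Set.mem_Ici.2 (abs_nonneg _)) ht ?_)
  simpa using hh

lemma Ph_cont {ω : ℝ → ℝ} (hω : IsModulus ω) {n : ℕ} (hn : 1 ≤ n) : Continuous (Ph ω n) := by
  rw [continuous_iff_continuousAt]
  intro x
  rw [ContinuousAt, tendsto_iff_dist_tendsto_zero]
  have hc : Continuous (fun y : ℝ => ω |y - x|) :=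
    hω.1.comp_continuous (by fun_prop) (fun y => Set.mem_Ici.2 (abs_nonneg _))
  have h1 : Tendsto (fun y : ℝ => ω |y - x|) (nhds x) (nhds 0) := by
    have := hc.tendsto x
    simpa [hω.2.2.2.1] using this
  exact squeeze_zero (fun y => dist_nonneg) (fun y => Ph_lip hω hn y x) h1

lemma Ph_anti {ω : ℝ → ℝ} (hω : IsModulus ω) {n : ℕ} (hn : 1 ≤ n) (x : ℝ) :
    Ph ω n (x + π / n) = - Ph ω n x := by
  have hn' : (0:ℝ) < n := by exact_mod_cast hn
  unfold Ph
  rw [← Sf_neg hω]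
  have : (n:ℝ) * (x + π / n) = n * x + π := by field_simp
  rw [this, Real.sin_add_pi, Real.arcsin_neg, neg_div]

lemma anti_nat {g : ℝ → ℝ} {c : ℝ} (h : ∀ x, g (x + c) = - g x) (k : ℕ) (x : ℝ) :
    g (x + k * c) = (-1) ^ k * g x := by
  induction k with
  | zero => simp
  | succ k ih =>
    have : x + ((k + 1 : ℕ) : ℝ) * c = (x + k * c) + c := by push_cast; ring
    rw [this, h, ih]; ring

lemma Ph_per {ω : ℝ → ℝ} (hω : IsModulus ω) {n : ℕ} (hn : 1 ≤ n) :
    Function.Periodic (Ph ω n) (2 * π) := by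
  intro x
  have hn' : (0:ℝ) < n := by exact_mod_cast hn
  have := anti_nat (Ph_anti hω hn) (2 * n) x
  rw [pow_mul] at this
  have e : ((2 * n : ℕ) : ℝ) * (π / n) = 2 * π := by push_cast; field_simp
  rw [e] at this
  simpa using this

lemma Ph_bdd {ω : ℝ → ℝ} (hω : IsModulus ω) {n : ℕ} (hn : 1 ≤ n) (x : ℝ) :
    |Ph ω n x| ≤ 3 / 2 * ω (1 / n) := by
  have hn' : (0:ℝ) < n := by exact_mod_cast hn
  have hw : 0 ≤ ω (1 / n) := hω.2.2.2.2 _ (by positivity)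
  have key : ∀ y : ℝ, 0 ≤ y → y ≤ π / 2 / n → |Sf ω y| ≤ 3 / 2 * ω (1 / n) := by
    intro y hy hy2
    unfold Sf
    rw [if_pos hy, abs_of_nonneg (by have := hω.2.2.2.2 (2 * y) (by linarith); linarith)]
    have := om_le hω hn (by linarith : 0 ≤ 2 * y)
    rw [le_div_iff₀ hn'] at hy2
    have h3 : (1 + n * (2 * y)) ≤ 9 / 2 := by nlinarith [Real.pi_lt_d2]
    nlinarith
  have p1 := Real.arcsin_le_pi_div_two (Real.sin (n * x))
  have p2 := Real.neg_pi_div_two_le_arcsin (Real.sin (n * x))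
  unfold Ph
  set p := Real.arcsin (Real.sin (n * x))
  rcases le_total 0 p with h | h
  · exact key _ (by positivity) (div_le_div_of_nonneg_right p1 hn'.le)
  · have := key (-(p / n)) (by rw [← neg_div]; exact div_nonneg (by linarith) hn'.le)
      (by rw [← neg_div]; exact div_le_div_of_nonneg_right (by linarith) hn'.le)
    rwa [Sf_neg hω, abs_neg] at this

lemma Ph_small {ω : ℝ → ℝ} {n : ℕ} (hn : 1 ≤ n) {u : ℝ} (h0 : 0 ≤ u) (h1 : u ≤ π / 2 / n) :
    Ph ω n u = ω (2 * u) / 3 := by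
  have hn' : (0:ℝ) < n := by exact_mod_cast hn
  rw [le_div_iff₀ hn'] at h1
  unfold Ph
  rw [Real.arcsin_sin (by nlinarith [Real.pi_pos]) (by linarith), mul_div_cancel_left₀ _ hn'.ne']
  unfold Sf
  rw [if_pos h0]

lemma Ph_neg {ω : ℝ → ℝ} (hω : IsModulus ω) (n : ℕ) (u : ℝ) : Ph ω n (-u) = - Ph ω n u := by
  unfold Ph
  rw [← Sf_neg hω, mul_neg, Real.sin_neg, Real.arcsin_neg, neg_div]

lemma Ph_mean {ω : ℝ → ℝ} (hω : IsModulus ω) (n : ℕ) : ∫ t in (-π)..π, Ph ω n t = 0 := by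
  have := intervalIntegral.integral_comp_neg (a := -π) (b := π) (Ph ω n)
  simp_rw [Ph_neg hω, intervalIntegral.integral_neg, neg_neg] at this
  linarith

lemma Ph_coef {ω : ℝ → ℝ} (hω : IsModulus ω) {n : ℕ} (hn : 1 ≤ n) :
    ∫ u in (-π)..π, Real.sin (n * u) * Ph ω n u = 4 / 3 * eN n ω := by
  have hn' : (0:ℝ) < n := by exact_mod_cast hn
  set F : ℝ → ℝ := fun u => Real.sin (n * u) * Ph ω n u with hF
  have hc : Continuous F := by have := Ph_cont hω hn; fun_prop
  have hper : Function.Periodic F (π / n) := by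
    intro u
    simp only [hF]
    have : (n:ℝ) * (u + π / n) = n * u + π := by field_simp
    rw [this, Real.sin_add_pi, Ph_anti hω hn]; ring
  have h1 := hper.intervalIntegral_add_zsmul_eq (2 * n : ℕ) (-π) (fun _ _ => hc.intervalIntegrable _ _)
  have e1 : -π + ((2 * n : ℕ) : ℤ) • (π / n) = π := by
    rw [zsmul_eq_mul]; push_cast; field_simp; ring
  rw [e1, hper.intervalIntegral_add_eq (-π) (-(π / 2 / n))] at h1
  have e2 : -(π / 2 / n) + π / n = π / 2 / n := by field_simp; ring
  rw [e2] at h1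
  have h2 : ∫ u in (-(π / 2 / n))..(π / 2 / n), F u = 2 * ∫ u in (0:ℝ)..(π / 2 / n), F u := by
    rw [← intervalIntegral.integral_add_adjacent_intervals (b := 0) (hc.intervalIntegrable _ _)
      (hc.intervalIntegrable _ _)]
    have := intervalIntegral.integral_comp_neg (a := 0) (b := π / 2 / n) F
    have ev : ∀ u, F (-u) = F u := fun u => by
      simp only [hF]; rw [Ph_neg hω, mul_neg (n:ℝ) u, Real.sin_neg]; ring
    simp_rw [ev, neg_zero] at this
    rw [← this]; ring
  have h3 : ∫ u in (0:ℝ)..(π / 2 / n), F u = (1 / (3 * n)) * eN n ω := by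
    have a1 : ∫ u in (0:ℝ)..(π / 2 / n), F u
        = ∫ u in (0:ℝ)..(π / 2 / n), (fun v => ω (2 * v / n) * Real.sin v / 3) (n * u) := by
      apply intervalIntegral.integral_congr
      intro u hu
      rw [Set.uIcc_of_le (by positivity)] at hu
      simp only [hF]
      rw [Ph_small hn hu.1 hu.2]
      have : 2 * (n * u) / n = 2 * u := by field_simp
      rw [this]; ring
    rw [a1, intervalIntegral.integral_comp_mul_left (fun v => ω (2 * v / n) * Real.sin v / 3) hn'.ne']
    have : (n:ℝ) * (π / 2 / n) = π / 2 := by field_simp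
    rw [this, mul_zero, intervalIntegral.integral_div]
    unfold eN
    rw [smul_eq_mul]
    field_simp
  rw [h1, h2, h3, zsmul_eq_mul]
  push_cast
  field_simp
  ring

lemma Hk_zero {φ : ℝ → ℝ} (hφ : Continuous φ) (hp : Function.Periodic φ (2 * π)) {n : ℕ}
    (ha : ∀ x, φ (x + π / n) = - φ x) (θ : ℝ) (k : ℤ) (hk : Real.cos (k * (π / n)) ≠ -1) (x : ℝ) :
    Hk φ θ k x = 0 := by
  set δ := (k:ℝ) * (π / n) with hδ
  have shift : ∀ θ, Hk φ θ k x = - Hk φ (θ - δ) k x := by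
    intro θ
    unfold Hk
    rw [← mul_neg, ← intervalIntegral.integral_neg]
    congr 1
    set G : ℝ → ℝ := fun t => φ (x - t) * Real.cos (k * t - θ) with hG
    have hGp : Function.Periodic G (2 * π) := by
      intro t
      simp only [hG]
      have e1 : x - (t + 2 * π) = (x - t) - 2 * π := by ring
      have e2 : (k:ℝ) * (t + 2 * π) - θ = (k * t - θ) + k * (2 * π) := by ring
      rw [e1, hp.sub_eq, e2, Real.cos_add_int_mul_two_pi]
    have h1 := hGp.intervalIntegral_add_eq (-π) (-π + π / n)
    have e1 : -π + 2 * π = π := by ring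
    have e2 : -π + π / n + 2 * π = π + π / n := by ring
    rw [e1, e2, ← intervalIntegral.integral_comp_add_right] at h1
    rw [h1]
    apply intervalIntegral.integral_congr
    intro t _
    simp only [hG]
    have := ha (x - (t + π / n))
    have e3 : x - (t + π / n) + π / n = x - t := by ring
    rw [e3] at this
    have e4 : (k:ℝ) * (t + π / n) - θ = k * t - (θ - δ) := by rw [hδ]; ring
    rw [e4, this]; ring
  have hsum : Hk φ (θ - δ) k x + Hk φ (θ + δ) k x = 2 * Real.cos δ * Hk φ θ k x := by
    unfold Hk
    rw [← mul_add, ← intervalIntegral.integral_add, mul_left_comm,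
      ← intervalIntegral.integral_const_mul (2 * Real.cos δ)]
    · congr 1
      apply intervalIntegral.integral_congr
      intro t _
      simp only
      have e1 : (k:ℝ) * t - (θ - δ) = (k * t - θ) + δ := by ring
      have e2 : (k:ℝ) * t - (θ + δ) = (k * t - θ) - δ := by ring
      rw [e1, e2, Real.cos_add, Real.cos_sub _ δ]; ring
    · apply Continuous.intervalIntegrable; fun_prop
    · apply Continuous.intervalIntegrable; fun_prop
  have s1 := shift θ
  have s2 := shift (θ + δ)
  rw [add_sub_cancel_right] at s2
  have : (1 + Real.cos δ) * Hk φ θ k x = 0 := by linarith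
  rcases mul_eq_zero.1 this with h | h
  · exact absurd (by linarith) hk
  · exact h

lemma alt_shift {g : ℝ → ℝ} (hg : Function.Periodic g (2 * π)) {n : ℕ} (hn : 1 ≤ n) (x : ℝ) :
    ∑ k ∈ Finset.range (2 * n), (-1 : ℝ) ^ k * g (x + π / n + k * (π / n))
      = - ∑ k ∈ Finset.range (2 * n), (-1 : ℝ) ^ k * g (x + k * (π / n)) := by
  have hn' : (0:ℝ) < n := by exact_mod_cast hn
  have h1 := Finset.sum_range_succ (fun k : ℕ => (-1 : ℝ) ^ k * g (x + k * (π / n))) (2 * n)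
  have h2 := Finset.sum_range_succ' (fun k : ℕ => (-1 : ℝ) ^ k * g (x + k * (π / n))) (2 * n)
  have e : x + ((2 * n : ℕ) : ℝ) * (π / n) = x + 2 * π := by push_cast; field_simp
  rw [e, hg x, pow_mul] at h1
  have e2 : ∀ k : ℕ, (-1 : ℝ) ^ (k + 1) * g (x + ((k + 1 : ℕ) : ℝ) * (π / n))
      = - ((-1 : ℝ) ^ k * g (x + π / n + k * (π / n))) := by
    intro k
    have : x + ((k + 1 : ℕ) : ℝ) * (π / n) = x + π / n + k * (π / n) := by push_cast; ring
    rw [this]; ring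
  simp_rw [e2, Finset.sum_neg_distrib] at h2
  simp only [even_two, Even.neg_pow, one_pow, Nat.cast_zero, zero_mul, add_zero, pow_zero] at h1 h2
  linarith

lemma alt_cos {n j : ℕ} (hj : j < n) (α x : ℝ) :
    ∑ k ∈ Finset.range (2 * n), (-1 : ℝ) ^ k * Real.cos (j * (x + k * (π / n)) - α) = 0 := by
  have hn : 1 ≤ n := by omega
  have hn' : (0:ℝ) < n := by exact_mod_cast hn
  set G : ℝ → ℝ := fun x => ∑ k ∈ Finset.range (2 * n), (-1 : ℝ) ^ k * Real.cos (j * (x + k * (π / n)) - α)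
    with hG
  have hper : Function.Periodic (fun y : ℝ => Real.cos (j * y - α)) (2 * π) := by
    intro y
    have : (j:ℝ) * (y + 2 * π) - α = j * y - α + j * (2 * π) := by ring
    simp only [this, Real.cos_add_nat_mul_two_pi]
  have hsh : ∀ x, G (x + π / n) = - G x := fun x => alt_shift hper hn x
  set δ := (j:ℝ) * (π / n) with hδ
  have hsum : G (x + π / n) + G (x - π / n) = 2 * Real.cos δ * G x := by
    simp only [hG]
    rw [← Finset.sum_add_distrib, Finset.mul_sum]
    apply Finset.sum_congr rfl
    intro k _
    have e1 : (j:ℝ) * (x + π / n + k * (π / n)) - α = (j * (x + k * (π / n)) - α) + δ := by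
      rw [hδ]; ring
    have e2 : (j:ℝ) * (x - π / n + k * (π / n)) - α = (j * (x + k * (π / n)) - α) - δ := by
      rw [hδ]; ring
    rw [e1, e2, Real.cos_add, Real.cos_sub _ δ]; ring
  have s1 := hsh x
  have s2 := hsh (x - π / n)
  rw [sub_add_cancel] at s2
  have h0 : (1 + Real.cos δ) * G x = 0 := by linarith
  have hlt : -1 < Real.cos δ := by
    rw [← Real.cos_pi]
    apply Real.strictAntiOn_cos ⟨by positivity, _⟩ ⟨Real.pi_pos.le, le_rfl⟩
    · rw [hδ, mul_div_assoc', div_lt_iff₀ hn', mul_comm]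
      exact mul_lt_mul_of_pos_left (by exact_mod_cast hj) Real.pi_pos
    · rw [hδ, mul_div_assoc', div_le_iff₀ hn', mul_comm]
      exact mul_le_mul_of_nonneg_left (by exact_mod_cast hj.le) Real.pi_pos.le
  rcases mul_eq_zero.1 h0 with h | h
  · linarith
  · exact h

lemma alt_trig {n : ℕ} {T : ℝ → ℝ} (hT : IsTrigPoly n T) (x : ℝ) :
    ∑ k ∈ Finset.range (2 * n), (-1 : ℝ) ^ k * T (x + k * (π / n)) = 0 := by
  obtain ⟨a, b, h⟩ := hT
  simp_rw [h, Finset.mul_sum]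
  rw [Finset.sum_comm]
  apply Finset.sum_eq_zero
  intro j hj
  have h1 := alt_cos (Finset.mem_range.1 hj) 0 x
  have h2 := alt_cos (Finset.mem_range.1 hj) (π / 2) x
  simp_rw [Real.cos_sub_pi_div_two] at h2
  simp_rw [sub_zero] at h1
  have : ∑ k ∈ Finset.range (2 * n), (-1 : ℝ) ^ k * (a j * Real.cos (j * (x + k * (π / n)))
      + b j * Real.sin (j * (x + k * (π / n))))
      = a j * ∑ k ∈ Finset.range (2 * n), (-1 : ℝ) ^ k * Real.cos (j * (x + k * (π / n)))
       + b j * ∑ k ∈ Finset.range (2 * n), (-1 : ℝ) ^ k * Real.sin (j * (x + k * (π / n))) := by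
    rw [Finset.mul_sum, Finset.mul_sum, ← Finset.sum_add_distrib]
    apply Finset.sum_congr rfl; intro k _; ring
  rw [this, h1, h2]; ring

lemma EnC_lower {n : ℕ} (hn : 1 ≤ n) {f : ℝ → ℝ} (hf : Continuous f)
    (hp : Function.Periodic f (2 * π)) (ha : ∀ x, f (x + π / n) = - f x) (x : ℝ) :
    f x ≤ EnC n f := by
  have hn' : (0:ℝ) < n := by exact_mod_cast hn
  refine le_csInf (EnC_set_nonempty n f) ?_
  rintro _ ⟨T, hT, rfl⟩
  obtain ⟨C, -, hC⟩ := per_bdd hf hp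
  obtain ⟨D, hD⟩ := hT.bounded
  have hb : BddAbove (Set.range fun x => |f x - T x|) := by
    refine ⟨C + D, ?_⟩
    rintro _ ⟨y, rfl⟩
    exact (abs_sub _ _).trans (add_le_add (hC y) (hD y))
  set s := ⨆ x, |f x - T x|
  have hs : ∀ y, |f y - T y| ≤ s := fun y => le_ciSup hb y
  have h1 : ∑ k ∈ Finset.range (2 * n), (-1 : ℝ) ^ k * (f (x + k * (π / n)) - T (x + k * (π / n)))
      = (2 * n) * f x := by
    simp_rw [mul_sub, Finset.sum_sub_distrib, alt_trig hT, anti_nat ha, sub_zero, ← mul_assoc,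
      ← mul_pow]
    simp
  have h2 : ∑ k ∈ Finset.range (2 * n), (-1 : ℝ) ^ k * (f (x + k * (π / n)) - T (x + k * (π / n)))
      ≤ ∑ k ∈ Finset.range (2 * n), s := by
    apply Finset.sum_le_sum
    intro k _
    refine (le_abs_self _).trans ?_
    rw [abs_mul, abs_pow, abs_neg, abs_one, one_pow, one_mul]
    exact hs _
  rw [h1] at h2
  simp only [Finset.sum_const, Finset.card_range, nsmul_eq_mul] at h2
  push_cast at h2
  exact le_of_mul_le_mul_left h2 (by positivity)

def FF (ψ : ℝ → ℝ) (β : ℝ) (ω : ℝ → ℝ) (n : ℕ) (x : ℝ) : ℝ :=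
  (1 / π) * ∫ t in (-π)..π, Ph ω n (x - t) * PsiKer ψ β t

lemma FF_anti {ψ ω : ℝ → ℝ} (hω : IsModulus ω) (β : ℝ) {n : ℕ} (hn : 1 ≤ n) (x : ℝ) :
    FF ψ β ω n (x + π / n) = - FF ψ β ω n x := by
  unfold FF
  rw [← mul_neg, ← intervalIntegral.integral_neg]
  congr 1
  apply intervalIntegral.integral_congr
  intro t _
  have : x + π / n - t = x - t + π / n := by ring
  simp only [this, Ph_anti hω hn]
  ring

lemma FF_per {ψ ω : ℝ → ℝ} (hω : IsModulus ω) (β : ℝ) {n : ℕ} (hn : 1 ≤ n) :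
    Function.Periodic (FF ψ β ω n) (2 * π) := by
  intro x
  unfold FF
  congr 1
  apply intervalIntegral.integral_congr
  intro t _
  have : x + 2 * π - t = x - t + 2 * π := by ring
  simp only [this, Ph_per hω hn (x - t)]

lemma FF_cont {ψ ω : ℝ → ℝ} (hs : Summable (fun k : ℕ => ψ k)) (hω : IsModulus ω) (β : ℝ) {n : ℕ}
    (hn : 1 ≤ n) : Continuous (FF ψ β ω n) := by
  have hφ := Ph_cont hω hn
  have hp := Ph_per hω hn
  have e : FF ψ β ω n = fun x => ∑' k : ℕ, ψ ((k + 1 : ℕ) : ℝ) *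
      Hk (Ph ω n) (β * π / 2) ((k + 1 : ℕ) : ℤ) x := by
    ext x
    exact (f_series hs hφ hp β x).tsum_eq.symm
  rw [e]
  have hs' : Summable (fun k : ℕ => ψ ((k + 1 : ℕ) : ℝ)) := (summable_nat_add_iff 1).2 hs
  refine continuous_tsum (u := fun k : ℕ => ‖ψ ((k + 1 : ℕ) : ℝ)‖ * (2 * (3 / 2 * ω (1 / n))))
    (fun k => continuous_const.mul ?_) (hs'.norm.mul_right _) (fun k x => ?_)
  · exact (Hk_trig hφ hp (n := k + 2) _ (by rw [abs_of_nonneg (by positivity)]; push_cast; linarith)).continuous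
  · rw [norm_mul]
    exact mul_le_mul_of_nonneg_left (Hk_bdd (Ph_bdd hω hn) _ _ _) (norm_nonneg _)

lemma FF_mem {ψ ω : ℝ → ℝ} (hs : Summable (fun k : ℕ => ψ k)) (hω : IsModulus ω) (β : ℝ) {n : ℕ}
    (hn : 1 ≤ n) : FF ψ β ω n ∈ CClass ψ β ω :=
  ⟨FF_cont hs hω β hn, FF_per hω β hn, 0, Ph ω n, Ph_cont hω hn, Ph_per hω hn, Ph_mean hω n,
    Ph_HM hω hn, fun x => by simp [FF]⟩

lemma FF_val {ψ η ω : ℝ → ℝ} (h : IsMInfPlus ψ η) {n : ℕ} (hn : 2 < (n:ℝ) / (η n - n))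
    (hω : IsModulus ω) (β : ℝ) :
    (4 / (3 * π)) * ψ n * eN n ω - 21 * ψ (3 * n) * ω (1 / n)
      ≤ FF ψ β ω n ((β * π / 2 + π / 2) / n) := by
  obtain ⟨h1, -⟩ := setup h hn
  have hn' : (0:ℝ) < n := by exact_mod_cast h1
  have h1' : (1:ℝ) ≤ n := by exact_mod_cast h1
  have hs := psi_summable h hn
  have hφ := Ph_cont hω h1
  have hp := Ph_per hω h1
  set θ := β * π / 2 with hθ
  set x0 := (θ + π / 2) / n with hx0
  have hser := f_series hs hφ hp β x0
  rw [← hθ] at hser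
  have hw : 0 ≤ ω (1 / n) := hω.2.2.2.2 _ (by positivity)
  -- restrict to odd multiples
  set g : ℕ → ℕ := fun i => (2 * i + 1) * n - 1 with hg
  have hg1 : ∀ i, g i + 1 = n + i * (2 * n) := by
    intro i
    have : (2 * i + 1) * n = n + i * (2 * n) := by ring
    simp only [hg, this]; omega
  have hinj : Function.Injective g := by
    intro i j hij
    have a1 := hg1 i
    have a2 := hg1 j
    rw [hij, a2] at a1
    have : j * (2 * n) = i * (2 * n) := by omega
    exact (Nat.eq_of_mul_eq_mul_right (by omega) this).symm
  have hz : ∀ k ∉ Set.range g, ψ ((k + 1 : ℕ) : ℝ) * Hk (Ph ω n) θ ((k + 1 : ℕ) : ℤ) x0 = 0 := by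
    intro k hk
    rw [Hk_zero hφ hp (Ph_anti hω h1), mul_zero]
    intro hc
    apply hk
    rw [Real.cos_eq_neg_one_iff] at hc
    obtain ⟨m, hm⟩ := hc
    have e1 : ((k + 1 : ℕ) : ℝ) = (2 * m + 1) * n := by
      have hpi := Real.pi_pos
      push_cast at hm ⊢
      field_simp at hm
      linarith
    have e2 : ((k + 1 : ℕ) : ℤ) = (2 * m + 1) * n := by exact_mod_cast e1
    have hm0 : 0 ≤ m := by
      by_contra hneg
      push Not at hneg
      have : (2 * m + 1) * (n:ℤ) ≤ 0 :=
        mul_nonpos_of_nonpos_of_nonneg (by omega) (by positivity)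
      omega
    obtain ⟨i, rfl⟩ := Int.eq_ofNat_of_zero_le hm0
    refine ⟨i, ?_⟩
    have e3 : k + 1 = (2 * i + 1) * n := by exact_mod_cast e2
    simp only [hg]; omega
  have hser2 := (hinj.hasSum_iff hz).2 hser
  have hFF : HasSum (fun i : ℕ => ψ ((g i + 1 : ℕ) : ℝ) * Hk (Ph ω n) θ ((g i + 1 : ℕ) : ℤ) x0)
      (FF ψ β ω n x0) := hser2
  have hsplit := hFF.summable.sum_add_tsum_nat_add 1
  rw [hFF.tsum_eq, Finset.sum_range_one] at hsplit
  have hpos : ∀ i : ℕ, 0 ≤ ψ (3 * n + i * (2 * n)) := fun i =>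
    (h.1 _ (by change (1:ℝ) ≤ _; have : (0:ℝ) ≤ i * (2 * n) := by positivity
               linarith)).le
  have hsB : Summable (fun i : ℕ => ψ (3 * n + i * (2 * n))) :=
    summable_of_sum_range_le hpos (tailB h hn)
  have hB : ∑' i : ℕ, ψ (3 * n + i * (2 * n)) ≤ 7 * ψ (3 * n) :=
    hsB.tsum_le_of_sum_range_le (tailB h hn)
  have htail := tsum_of_norm_bounded
    (f := fun i : ℕ => ψ ((g (i + 1) + 1 : ℕ) : ℝ) * Hk (Ph ω n) θ ((g (i + 1) + 1 : ℕ) : ℤ) x0)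
    ((hsB.mul_right (2 * (3 / 2 * ω (1 / n)))).hasSum) (fun i => by
      have e : ((g (i + 1) + 1 : ℕ) : ℝ) = 3 * n + i * (2 * n) := by
        rw [hg1]; push_cast; ring
      rw [norm_mul, e, Real.norm_eq_abs, abs_of_nonneg (hpos i)]
      exact mul_le_mul_of_nonneg_left (Hk_bdd (Ph_bdd hω h1) _ _ _) (hpos i))
  rw [tsum_mul_right, Real.norm_eq_abs] at htail
  have htail2 := htail.trans (mul_le_mul_of_nonneg_right hB (by positivity))
  have hmain : Hk (Ph ω n) θ ((g 0 + 1 : ℕ) : ℤ) x0 = 4 / (3 * π) * eN n ω := by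
    rw [hg1]
    unfold Hk
    have hTper : Function.Periodic (fun t : ℝ => Real.cos (n * t - θ)) (2 * π) := by
      intro y
      have : (n:ℝ) * (y + 2 * π) - θ = n * y - θ + n * (2 * π) := by ring
      simp only [this, Real.cos_add_nat_mul_two_pi]
    have hcc := conv_comm hp hTper x0
    have e1 : (((n + 0 * (2 * n) : ℕ) : ℤ) : ℝ) = n := by simp
    rw [e1, hcc]
    have e2 : ∀ u : ℝ, Real.cos (n * (x0 - u) - θ) = Real.sin (n * u) := by
      intro u
      rw [← Real.cos_pi_div_two_sub]
      congr 1
      rw [hx0]; field_simp; ring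
    simp_rw [e2]
    rw [Ph_coef hω h1]
    field_simp
  have e0 : ((g 0 + 1 : ℕ) : ℝ) = n := by rw [hg1]; simp
  rw [hmain, e0] at hsplit
  have := (abs_le.1 htail2).1
  rw [← hsplit]
  linarith

/-- For arbitrary moduli of continuity, two-sided estimate
`(4/(3π)) ψ(n) e_n(ω) − K γ_n(ψ) ω(1/n) ≤ E_n(C^ψ_β H_{ω_C})_C ≤ (2/π) ψ(n) e_n(ω) + K γ_n(ψ) ω(1/n)`
whenever `μ(n) > 2`. -/
theorem statement1 :
    ∃ K : ℝ, 0 < K ∧ ∀ ψ η : ℝ → ℝ, IsMInfPlus ψ η → ∀ β : ℝ, ∀ ω : ℝ → ℝ,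
      IsModulus ω → ∀ n : ℕ,
      2 < (n : ℝ) / (η n - n) →
      (4 / (3 * π)) * ψ n * eN n ω - K * gammaN ψ η n * ω (1 / n) ≤
          EnCClass n (CClass ψ β ω) ∧
        EnCClass n (CClass ψ β ω) ≤
          (2 / π) * ψ n * eN n ω + K * gammaN ψ η n * ω (1 / n) := by
  refine ⟨3000, by norm_num, fun ψ η h β ω hω n hn => ?_⟩
  obtain ⟨h1, -⟩ := setup h hn
  have h1' : (1:ℝ) ≤ n := by exact_mod_cast h1
  have hw : 0 ≤ ω (1 / n) := hω.2.2.2.2 _ (by positivity)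
  have hmem := FF_mem (psi_summable h hn) hω β h1
  have hub : ∀ e ∈ EnC n '' CClass ψ β ω,
      e ≤ (2 / π) * ψ n * eN n ω + 3000 * gammaN ψ η n * ω (1 / n) := by
    rintro _ ⟨f, hf, rfl⟩
    exact EnC_upper h hn hω β hf
  refine ⟨?_, csSup_le ⟨_, _, hmem, rfl⟩ hub⟩
  refine le_trans ?_ (le_csSup ⟨_, hub⟩ ⟨_, hmem, rfl⟩)
  refine le_trans ?_ (EnC_lower h1 (FF_cont (psi_summable h hn) hω β h1) (FF_per hω β h1)
    (FF_anti hω β h1) ((β * π / 2 + π / 2) / n))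
  refine le_trans ?_ (FF_val h hn hω β)
  have p1 : 0 < ψ (n + 1) := h.1 _ (by change (1:ℝ) ≤ _; linarith)
  have p3 : 0 < ψ (3 * n) := h.1 _ (by change (1:ℝ) ≤ _; linarith)
  unfold gammaN
  set μ := (n:ℝ) / (η n - n)
  have hL : 0 ≤ max 0 (Real.log (η n - n)) := le_max_left _ _
  set Lg := max 0 (Real.log (η n - n))
  have hμ : 0 < μ - 2 := by linarith
  have q1 : 0 ≤ ψ (n + 1) * (1 / n + 1 / (μ - 2)) * ω (1 / n) := by positivity
  have q2 : 0 ≤ ψ (3 * n) * ω (1 / n) := by positivity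
  have q3 : 0 ≤ ψ (3 * n) * Lg * ω (1 / n) := by positivity
  linarith
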